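/- arXiv:1502.01202 — 4 statements merged into one kernel-verified Lean document; each statement's English description precedes it below -/
import Mathlib

section
/- There exist R > 0 and three holomorphic functions y₁, y₂, y₃ on {z ∈ ℂ : |z| > R} such that for every z with |z| > R the values y₁(z), y₂(z), y₃(z) are the three pairwise distinct solutions of the cubic equation (z²−1)² y³ − 3(z²−1) y + 2z = 0, they satisfy y₁(z) + y₂(z) + y₃(z) = 0, and they have the asymptotic behavior y₁(z) = 1/z + O(1/z²), y₂(z) = 1/z + O(1/z²), y₃(z) = −2/z + O(1/z²) as z → ∞. -/
open Filter Asymptotics Bornology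

/-- Branch of the rescaled solution, `t = 1/z`. -/
noncomputable def auxV (w t : ℂ) : ℂ :=
  -(w * (1 + t) ^ (1 / 3 : ℂ) + w ^ 2 * (1 - t) ^ (1 / 3 : ℂ)) /
    ((1 + t) ^ (1 / 3 : ℂ) * (1 - t) ^ (1 / 3 : ℂ)) ^ 2

theorem aux_cube (x : ℂ) : (x ^ (1 / 3 : ℂ)) ^ 3 = x := by
  have := Complex.cpow_nat_inv_pow x (n := 3) (by norm_num)
  simpa using this

theorem aux_slit (t : ℂ) (h : ‖t‖ < 1) : 1 + t ∈ Complex.slitPlane := by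
  exact Complex.mem_slitPlane_of_norm_lt_one h

theorem aux_ne (t : ℂ) (h : ‖t‖ < 1) : (1 + t) ^ (1 / 3 : ℂ) ≠ 0 := by
  intro h0
  have h1 := aux_cube (1 + t)
  rw [h0] at h1
  exact Complex.slitPlane_ne_zero (aux_slit t h) (by rw [← h1]; norm_num)

theorem aux_ne' (t : ℂ) (h : ‖t‖ < 1) : (1 - t) ^ (1 / 3 : ℂ) ≠ 0 := by
  rw [sub_eq_add_neg]
  exact aux_ne (-t) (by simpa using h)

theorem aux_diff (w t : ℂ) (h : ‖t‖ < 1) : DifferentiableAt ℂ (auxV w) t := by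
  have h1 := aux_slit t h
  have h2 : 1 - t ∈ Complex.slitPlane := by
    rw [sub_eq_add_neg]
    exact aux_slit (-t) (by simpa using h)
  have d1 : DifferentiableAt ℂ (fun t : ℂ => (1 + t) ^ (1 / 3 : ℂ)) t :=
    DifferentiableAt.cpow (by fun_prop) (by fun_prop) h1
  have d2 : DifferentiableAt ℂ (fun t : ℂ => (1 - t) ^ (1 / 3 : ℂ)) t :=
    DifferentiableAt.cpow (by fun_prop) (by fun_prop) h2
  unfold auxV
  refine DifferentiableAt.div ?_ ?_ ?_
  · exact ((d1.const_mul w).add (d2.const_mul (w ^ 2))).neg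
  · exact (d1.mul d2).pow 2
  · exact pow_ne_zero _ (mul_ne_zero (aux_ne t h) (aux_ne' t h))

theorem aux_zero (w : ℂ) : auxV w 0 = -(w + w ^ 2) := by
  simp [auxV]

theorem aux_norm {z : ℂ} (hz : 1 < ‖z‖) : z ≠ 0 ∧ ‖z⁻¹‖ < 1 := by
  constructor
  · rintro rfl
    norm_num at hz
  · rw [norm_inv]
    exact inv_lt_one_of_one_lt₀ hz

theorem aux_diffOn (w : ℂ) :
    DifferentiableOn ℂ (fun z => auxV w z⁻¹ * z⁻¹) {z : ℂ | (1 : ℝ) < ‖z‖} := by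
  intro z hz
  obtain ⟨h0, h1⟩ := aux_norm hz
  have hi : DifferentiableAt ℂ (fun z : ℂ => z⁻¹) z := differentiableAt_inv h0
  have hc : DifferentiableAt ℂ (fun z : ℂ => auxV w z⁻¹) z :=
    DifferentiableAt.comp (g := auxV w) z (aux_diff w _ h1) hi
  exact (hc.mul hi).differentiableWithinAt

theorem aux_eq (w z : ℂ) (hw : w ^ 3 = 1) (hz : 1 < ‖z‖) :
    (z ^ 2 - 1) ^ 2 * (auxV w z⁻¹ * z⁻¹) ^ 3
      - 3 * (z ^ 2 - 1) * (auxV w z⁻¹ * z⁻¹) + 2 * z = 0 := by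
  obtain ⟨h0, h1⟩ := aux_norm hz
  have ha := aux_ne _ h1
  have hb := aux_ne' _ h1
  have ha3 := aux_cube (1 + z⁻¹)
  have hb3 := aux_cube (1 - z⁻¹)
  unfold auxV
  generalize (1 + z⁻¹) ^ (1 / 3 : ℂ) = a at *
  generalize (1 - z⁻¹) ^ (1 / 3 : ℂ) = b at *
  have hs : z ^ 2 - 1 = z ^ 2 * a ^ 3 * b ^ 3 := by
    rw [mul_assoc, ha3, hb3]
    field_simp
    ring
  have hsum : a ^ 3 + b ^ 3 = 2 := by
    rw [ha3, hb3]; ring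
  have hc : (w * a + w ^ 2 * b) ^ 3 = 2 + 3 * a * b * (w * a + w ^ 2 * b) := by
    linear_combination hsum +
      (a ^ 3 + b ^ 3 * (w ^ 3 + 1) + 3 * a * b * (w * a + w ^ 2 * b)) * hw
  rw [hs]
  generalize w * a + w ^ 2 * b = c at *
  field_simp
  linear_combination -z * hc

theorem aux_inj (w w' z : ℂ) (hw : w ^ 3 = 1) (hw' : w' ^ 3 = 1) (hne : w ≠ w')
    (hz : 1 < ‖z‖) : auxV w z⁻¹ * z⁻¹ ≠ auxV w' z⁻¹ * z⁻¹ := by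
  obtain ⟨h0, h1⟩ := aux_norm hz
  intro h
  have h := mul_right_cancel₀ (inv_ne_zero h0) h
  have ha := aux_ne _ h1
  have hb := aux_ne' _ h1
  have ha3 := aux_cube (1 + z⁻¹)
  have hb3 := aux_cube (1 - z⁻¹)
  unfold auxV at h
  generalize (1 + z⁻¹) ^ (1 / 3 : ℂ) = a at *
  generalize (1 - z⁻¹) ^ (1 / 3 : ℂ) = b at *
  rw [div_left_inj' (pow_ne_zero _ (mul_ne_zero ha hb))] at h
  have h2 : (w - w') * (a + (w + w') * b) = 0 := by linear_combination -h
  have h3 : a = -(w + w') * b := by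
    rcases mul_eq_zero.1 h2 with h4 | h4
    · exact absurd (sub_eq_zero.1 h4) hne
    · linear_combination h4
  have h5 : w ^ 2 + w * w' + w' ^ 2 = 0 := by
    have : (w - w') * (w ^ 2 + w * w' + w' ^ 2) = 0 := by linear_combination hw - hw'
    exact (mul_eq_zero.1 this).resolve_left (sub_ne_zero.2 hne)
  have h6 : a ^ 3 = b ^ 3 := by
    rw [h3]
    linear_combination (-(3 * w + 3 * w') * h5 + hw + hw') * b ^ 3 / 2
  have h7 : z⁻¹ = 0 := by linear_combination (h6 - ha3 + hb3) / 2
  exact inv_ne_zero h0 h7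

theorem aux_O (w : ℂ) :
    (fun z : ℂ => auxV w z⁻¹ * z⁻¹ - auxV w 0 / z) =O[cobounded ℂ]
      (fun z => (z ^ 2)⁻¹) := by
  have h := (aux_diff w 0 (by simp)).isBigO_sub
  have h2 := h.comp_tendsto (tendsto_inv₀_cobounded (α := ℂ))
  have h3 := h2.mul (isBigO_refl (fun z : ℂ => z⁻¹) (cobounded ℂ))
  refine h3.congr (fun z => ?_) (fun z => ?_)
  · simp only [Function.comp]; ring
  · simp only [Function.comp, sub_zero]; rw [← mul_inv, sq]

/-- In a neighborhood `{|z| > R}` of infinity there are three holomorphic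
functions `y₁, y₂, y₃` giving the three pairwise distinct solutions of the cubic
`(z²−1)² y³ − 3(z²−1) y + 2z = 0`, with `y₁ + y₂ + y₃ = 0`, and with the asymptotics
`y₁ = 1/z + O(1/z²)`, `y₂ = 1/z + O(1/z²)`, `y₃ = −2/z + O(1/z²)` as `z → ∞`. -/
theorem stmt_13 :
    ∃ R : ℝ, 0 < R ∧ ∃ y₁ y₂ y₃ : ℂ → ℂ,
      DifferentiableOn ℂ y₁ {z : ℂ | R < ‖z‖} ∧
      DifferentiableOn ℂ y₂ {z : ℂ | R < ‖z‖} ∧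
      DifferentiableOn ℂ y₃ {z : ℂ | R < ‖z‖} ∧
      (∀ z : ℂ, R < ‖z‖ →
        ((z ^ 2 - 1) ^ 2 * (y₁ z) ^ 3 - 3 * (z ^ 2 - 1) * y₁ z + 2 * z = 0 ∧
         (z ^ 2 - 1) ^ 2 * (y₂ z) ^ 3 - 3 * (z ^ 2 - 1) * y₂ z + 2 * z = 0 ∧
         (z ^ 2 - 1) ^ 2 * (y₃ z) ^ 3 - 3 * (z ^ 2 - 1) * y₃ z + 2 * z = 0 ∧
         y₁ z ≠ y₂ z ∧ y₁ z ≠ y₃ z ∧ y₂ z ≠ y₃ z ∧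
         y₁ z + y₂ z + y₃ z = 0)) ∧
      (fun z => y₁ z - 1 / z) =O[cobounded ℂ] (fun z => (z ^ 2)⁻¹) ∧
      (fun z => y₂ z - 1 / z) =O[cobounded ℂ] (fun z => (z ^ 2)⁻¹) ∧
      (fun z => y₃ z + 2 / z) =O[cobounded ℂ] (fun z => (z ^ 2)⁻¹) := by
  obtain ⟨r, hr⟩ := IsAlgClosed.exists_pow_nat_eq (-3 : ℂ) (n := 2) (by norm_num)
  obtain ⟨w, hw⟩ : ∃ w : ℂ, w ^ 2 + w + 1 = 0 :=
    ⟨(-1 + r) / 2, by linear_combination hr / 4⟩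
  have hw3 : w ^ 3 = 1 := by linear_combination (w - 1) * hw
  have hv3 : (w ^ 2) ^ 3 = 1 := by linear_combination (w ^ 3 + 1) * hw3
  have ho3 : (1 : ℂ) ^ 3 = 1 := by norm_num
  have n2 : w ≠ 1 := by
    rintro rfl
    norm_num at hw
  have n3 : w ^ 2 ≠ 1 := by
    intro h
    exact n2 (by linear_combination hw3 - w * h)
  have n1 : w ≠ w ^ 2 := by
    intro h
    exact n3 (by linear_combination w * h + hw3 - h + h)
  refine ⟨1, one_pos, fun z => auxV w z⁻¹ * z⁻¹, fun z => auxV (w ^ 2) z⁻¹ * z⁻¹,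
    fun z => auxV 1 z⁻¹ * z⁻¹, aux_diffOn _, aux_diffOn _, aux_diffOn _, ?_, ?_, ?_, ?_⟩
  · intro z hz
    refine ⟨aux_eq _ z hw3 hz, aux_eq _ z hv3 hz, aux_eq _ z ho3 hz,
      aux_inj _ _ z hw3 hv3 n1 hz, aux_inj _ _ z hw3 ho3 n2 hz,
      aux_inj _ _ z hv3 ho3 n3 hz, ?_⟩
    simp only [auxV]
    generalize (1 + z⁻¹) ^ (1 / 3 : ℂ) = a
    generalize (1 - z⁻¹) ^ (1 / 3 : ℂ) = b
    rw [← add_mul, ← add_mul, ← add_div, ← add_div]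
    have : -(w * a + w ^ 2 * b) + -(w ^ 2 * a + (w ^ 2) ^ 2 * b) + -(1 * a + 1 ^ 2 * b) = 0 := by
      linear_combination (-a - b) * hw - w * b * hw3
    rw [this]; simp
  · have h := aux_O w
    rwa [aux_zero, show -(w + w ^ 2) = 1 by linear_combination -hw] at h
  · have h := aux_O (w ^ 2)
    rwa [aux_zero, show -(w ^ 2 + (w ^ 2) ^ 2) = 1 by
      linear_combination -hw - w * hw3] at h
  · have h := aux_O 1
    rw [aux_zero] at h
    refine h.congr_left (fun z => ?_)
    ring
end

section
/- Let α ∈ ℝ with |α| ∈ (0,1/2), let f(z) = ((z−1)/(z+1))^α be the holomorphic branch on ℂ∖[−1,1] with f(∞) = 1, and let Q_{n,0}, Q_{n,1}, Q_{n,2} be type I Hermite–Padé polynomials of order n for (1, f, f²). Then for every polynomial q of degree ≤ 2n, ∫_{−1}^{1} [ Q_{n,1}(x) + 2cos(απ) Q_{n,2}(x) f_0(x) ] q(x) f_0(x) dx = 0, where f_0(x) = ((1−x)/(1+x))^α > 0 for x ∈ (−1,1). -/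
open Polynomial Filter Asymptotics Bornology Topology MeasureTheory

lemma reduce (b : ℂ) (P : ℂ[X]) : ∃ (c : ℂ) (p : ℂ[X]),
    P = C c + (derivative ((X ^ 2 - 1) * p) + C (2 * b) * p) := by
  have hX : ∀ k : ℕ, ∃ (c : ℂ) (p : ℂ[X]),
      (X : ℂ[X]) ^ k = C c + (derivative ((X ^ 2 - 1) * p) + C (2 * b) * p) := by
    intro k
    induction k using Nat.strong_induction_on with
    | _ k ih =>
      match k with
      | 0 => exact ⟨1, 0, by simp⟩
      | 1 =>
        refine ⟨-b, C (1 / 2), ?_⟩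
        apply Polynomial.funext
        intro z
        simp
        ring
      | k + 2 =>
        obtain ⟨c1, p1, h1⟩ := ih (k + 1) (by omega)
        obtain ⟨c2, p2, h2⟩ := ih k (by omega)
        have hk : ((k : ℂ) + 3) ≠ 0 := by
          have : ((k + 3 : ℕ) : ℂ) ≠ 0 := by exact Nat.cast_ne_zero.2 (by omega)
          simpa using this
        refine ⟨1 / (k + 3) * (-2 * b * c1 + (k + 1) * c2),
          C (1 / ((k : ℂ) + 3)) * (X ^ (k + 1) - C (2 * b) * p1 + C ((k : ℂ) + 1) * p2), ?_⟩
        apply Polynomial.funext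
        intro z
        have e1 := congrArg (eval z) h1
        have e2 := congrArg (eval z) h2
        simp at e1 e2 ⊢
        field_simp
        linear_combination (-2 * b) * e1 + (k + 1) * e2
  induction P using Polynomial.induction_on' with
  | add P R hP hR =>
    obtain ⟨c1, p1, h1⟩ := hP
    obtain ⟨c2, p2, h2⟩ := hR
    refine ⟨c1 + c2, p1 + p2, ?_⟩
    rw [h1, h2]
    simp only [mul_add, C_add, derivative_add]
    ring
  | monomial k a =>
    obtain ⟨c, p, h⟩ := hX k
    refine ⟨a * c, C a * p, ?_⟩
    rw [← C_mul_X_pow_eq_monomial, h]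
    have : (X ^ 2 - 1) * (C a * p) = C a * ((X ^ 2 - 1) * p) := by ring
    rw [this, derivative_C_mul, C_mul (a := a)]
    ring

lemma circ (g : ℂ → ℂ) (L : ℂ) (hc : ∀ R : ℝ, 1 < R → ContinuousOn g (Metric.sphere 0 R))
    (h0 : ∀ R : ℝ, 1 < R → (∮ z in C(0, R), g z) = 0)
    (hL : Tendsto (fun z => z * g z) (cobounded ℂ) (𝓝 L)) : L = 0 := by
  by_contra hne
  have hpos : 0 < ‖L‖ / 2 := by positivity
  have h1 := (Metric.tendsto_nhds.1 hL) _ hpos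
  have h2 := (hasBasis_cobounded_norm (E := ℂ)).eventually_iff.1 h1
  obtain ⟨r, -, hr⟩ := h2
  set R := max r 2 with hR
  have hR1 : 1 < R := by have := le_max_right r 2; linarith
  have hRr : r ≤ R := le_max_left _ _
  have hR0 : 0 < R := by linarith
  have hb : ∀ z ∈ Metric.sphere (0 : ℂ) R, ‖g z - L * (z - 0)⁻¹‖ ≤ ‖L‖ / 2 / R := by
    intro z hz
    have hz' : ‖z‖ = R := by simpa using hz
    have hz0 : z ≠ 0 := by rintro rfl; simp at hz'; linarith
    have := hr (x := z) (by simp [hz', hRr])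
    rw [dist_eq_norm] at this
    have e : g z - L * (z - 0)⁻¹ = (z * g z - L) / z := by field_simp; simp
    rw [e, norm_div, hz']
    gcongr
  have hn := circleIntegral.norm_integral_le_of_norm_le_const hR0.le hb
  rw [circleIntegral.integral_sub ((hc R hR1).circleIntegrable hR0.le), h0 R hR1] at hn
  · rw [circleIntegral.integral_const_mul, circleIntegral.integral_sub_center_inv _ hR0.ne'] at hn
    have e : ‖(0 : ℂ) - L * (2 * Real.pi * Complex.I)‖ = 2 * Real.pi * ‖L‖ := by
      simp [abs_of_pos Real.pi_pos]; ring
    rw [e] at hn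
    have e2 : 2 * Real.pi * R * (‖L‖ / 2 / R) = Real.pi * ‖L‖ := by field_simp
    rw [e2] at hn
    have := mul_pos Real.pi_pos (norm_pos_iff.2 hne)
    linarith
  · apply ContinuousOn.circleIntegrable hR0.le
    apply ContinuousOn.mul continuousOn_const
    apply ContinuousOn.inv₀ (by fun_prop)
    intro z hz h
    have hz' : ‖z‖ = R := by simpa using hz
    simp at h
    rw [h] at hz'
    simp at hz'; linarith

/-- the weight -/
noncomputable def wt (b : ℝ) (x : ℝ) : ℝ := ((1 - x) / (1 + x)) ^ b

lemma beta_eq (b : ℝ) (hb0 : b ≠ 0) (hb : |b| < 1) :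
    IntervalIntegrable (fun x : ℝ => ((wt b x : ℝ) : ℂ)) volume (-1) 1 ∧
    ∫ x in (-1 : ℝ)..1, ((wt b x : ℝ) : ℂ) = 2 * (b * (Real.pi / Complex.sin (Real.pi * b))) := by
  obtain ⟨hb1, hb2⟩ := abs_lt.1 hb
  have hu : 0 < ((1 : ℂ) - b).re := by simp; linarith
  have hv : 0 < ((1 : ℂ) + b).re := by simp; linarith
  have hconv := Complex.betaIntegral_convergent hu hv
  have hG := Complex.Gamma_mul_Gamma_eq_betaIntegral hu hv
  have hbC : (b : ℂ) ≠ 0 := by exact_mod_cast hb0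
  rw [show (1 : ℂ) - b + (1 + b) = 1 + 1 by ring, Complex.Gamma_add_one _ one_ne_zero,
    Complex.Gamma_one, add_comm (1 : ℂ) b, Complex.Gamma_add_one _ hbC] at hG
  have hR := Complex.Gamma_mul_Gamma_one_sub (b : ℂ)
  have heq : ∀ t ∈ Set.Ioo (0 : ℝ) 1, (t : ℂ) ^ ((1 : ℂ) - b - 1) * (1 - (t : ℂ)) ^ ((1 : ℂ) + b - 1)
      = ((wt b (2 * t - 1) : ℝ) : ℂ) := by
    intro t ht
    have h1 : 0 < t := ht.1
    have h2 : 0 < 1 - t := by linarith [ht.2]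
    have : wt b (2 * t - 1) = t ^ (-b) * (1 - t) ^ b := by
      unfold wt
      rw [show (1 - (2 * t - 1)) / (1 + (2 * t - 1)) = (1 - t) / t by field_simp; ring,
        Real.div_rpow h2.le h1.le, Real.rpow_neg h1.le]
      field_simp
    rw [this]
    push_cast
    rw [Complex.ofReal_cpow h1.le, Complex.ofReal_cpow h2.le]
    push_cast
    congr 2 <;> ring
  have hint : IntervalIntegrable (fun t : ℝ => ((wt b (2 * t - 1) : ℝ) : ℂ)) volume 0 1 := by
    rw [intervalIntegrable_iff_integrableOn_Ioo_of_le zero_le_one] at hconv ⊢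
    exact hconv.congr_fun heq measurableSet_Ioo
  constructor
  · have h := (hint.comp_mul_left (c := (1 / 2 : ℝ))).comp_add_right 1
    norm_num at h
    refine h.congr ?_
    intro x _
    dsimp only
    congr 2; ring
  · have h3 : ∫ t in (0 : ℝ)..1, ((wt b (2 * t - 1) : ℝ) : ℂ) = Complex.betaIntegral (1 - b) (1 + b) := by
      unfold Complex.betaIntegral
      rw [intervalIntegral.integral_of_le zero_le_one, intervalIntegral.integral_of_le zero_le_one,
        integral_Ioc_eq_integral_Ioo, integral_Ioc_eq_integral_Ioo]
      exact (setIntegral_congr_fun measurableSet_Ioo heq).symm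
    rw [intervalIntegral.integral_comp_mul_sub (fun x => ((wt b x : ℝ) : ℂ)) two_ne_zero] at h3
    norm_num at h3
    rw [← hR]
    rw [add_comm (b : ℂ) 1] at hG
    linear_combination 2 * h3 - 2 * hG

lemma red_int (b : ℝ) (hb0 : b ≠ 0) (hb : |b| < 1) (p : ℂ[X]) :
    ∫ x in (-1 : ℝ)..1, (derivative ((X ^ 2 - 1) * p) + C (2 * (b : ℂ)) * p).eval (x : ℂ)
      * ((wt b x : ℝ) : ℂ) = 0 := by
  obtain ⟨hb1, hb2⟩ := abs_lt.1 hb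
  set F : ℝ → ℂ := fun x => -(((1 - x) ^ (1 + b) * (1 + x) ^ (1 - b) : ℝ) : ℂ) * p.eval (x : ℂ)
  have hF : ContinuousOn F (Set.Icc (-1) 1) := by
    apply Continuous.continuousOn
    have h1 : Continuous fun x : ℝ => (1 - x) ^ (1 + b) :=
      (continuous_const.sub continuous_id).rpow_const (fun _ => Or.inr (by linarith))
    have h2 : Continuous fun x : ℝ => (1 + x) ^ (1 - b) :=
      (continuous_const.add continuous_id).rpow_const (fun _ => Or.inr (by linarith))
    have h3 : Continuous fun x : ℝ => p.eval (x : ℂ) := p.continuous.comp Complex.continuous_ofReal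
    exact (Complex.continuous_ofReal.comp (h1.mul h2)).neg.mul h3
  have key : ∀ x ∈ Set.Ioo (-1 : ℝ) 1, HasDerivAt F
      ((derivative ((X ^ 2 - 1) * p) + C (2 * (b : ℂ)) * p).eval (x : ℂ) * ((wt b x : ℝ) : ℂ)) x := by
    intro x hx
    have hx1 : 0 < 1 - x := by linarith [hx.2]
    have hx2 : 0 < 1 + x := by linarith [hx.1]
    have d1 : HasDerivAt (fun x : ℝ => (1 - x) ^ (1 + b)) (-1 * (1 + b) * (1 - x) ^ (1 + b - 1)) x :=
      ((hasDerivAt_id x).const_sub 1).rpow_const (Or.inl hx1.ne')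
    have d2 : HasDerivAt (fun x : ℝ => (1 + x) ^ (1 - b)) (1 * (1 - b) * (1 + x) ^ (1 - b - 1)) x :=
      ((hasDerivAt_id x).const_add 1).rpow_const (Or.inl hx2.ne')
    have d3 : HasDerivAt (fun x : ℝ => p.eval (x : ℂ)) (p.derivative.eval (x : ℂ)) x :=
      (p.hasDerivAt (x : ℂ)).comp_ofReal
    have d := ((d1.mul d2).ofReal_comp.neg).mul d3
    refine d.congr_deriv ?_
    have ew : wt b x = (1 - x) ^ b * (1 + x) ^ (-b) := by
      unfold wt
      rw [Real.div_rpow hx1.le hx2.le, Real.rpow_neg hx2.le]; rfl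
    simp only [Pi.mul_apply, Pi.neg_apply]
    rw [ew, show 1 + b - 1 = b by ring, show 1 - b - 1 = -b by ring,
      Real.rpow_add hx1, Real.rpow_one, show 1 - b = 1 + -b by ring, Real.rpow_add hx2, Real.rpow_one]
    simp
    ring
  have hI := (beta_eq b hb0 hb).1
  have hI2 : IntervalIntegrable (fun x : ℝ =>
      (derivative ((X ^ 2 - 1) * p) + C (2 * (b : ℂ)) * p).eval (x : ℂ) * ((wt b x : ℝ) : ℂ))
      volume (-1) 1 :=
    hI.continuousOn_mul (Polynomial.continuous _ |>.comp Complex.continuous_ofReal).continuousOn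
  rw [intervalIntegral.integral_eq_sub_of_hasDerivAt_of_le (by norm_num) hF key hI2]
  have h1 : (1 : ℝ) + b ≠ 0 := by linarith
  have h2 : (1 : ℝ) - b ≠ 0 := by linarith
  simp [F, Real.zero_rpow h1, Real.zero_rpow h2]

lemma full_int (b : ℝ) (hb0 : b ≠ 0) (hb : |b| < 1) (c : ℂ) (p : ℂ[X]) :
    ∫ x in (-1 : ℝ)..1, (C c + (derivative ((X ^ 2 - 1) * p) + C (2 * (b : ℂ)) * p)).eval (x : ℂ)
      * ((wt b x : ℝ) : ℂ) = c * (2 * (b * (Real.pi / Complex.sin (Real.pi * b)))) := by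
  obtain ⟨hI, hB⟩ := beta_eq b hb0 hb
  have h0 := red_int b hb0 hb p
  have e : ∀ x : ℝ, (C c + (derivative ((X ^ 2 - 1) * p) + C (2 * (b : ℂ)) * p)).eval (x : ℂ)
      * ((wt b x : ℝ) : ℂ) = c * ((wt b x : ℝ) : ℂ) +
      (derivative ((X ^ 2 - 1) * p) + C (2 * (b : ℂ)) * p).eval (x : ℂ) * ((wt b x : ℝ) : ℂ) := by
    intro x
    rw [eval_add, eval_C, add_mul]
  simp_rw [e]
  rw [intervalIntegral.integral_add (hI.const_mul c), h0, intervalIntegral.integral_const_mul, hB,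
    add_zero]
  exact hI.continuousOn_mul (Polynomial.continuous _ |>.comp Complex.continuous_ofReal).continuousOn

lemma coef_rel (α : ℝ) (hα0 : α ≠ 0)
    (f : ℂ → ℂ)
    (hf_dom : DifferentiableOn ℂ f {z : ℂ | ¬(z.im = 0 ∧ |z.re| ≤ 1)})
    (hf_pearson : ∀ z ∈ {z : ℂ | ¬(z.im = 0 ∧ |z.re| ≤ 1)},
      (z ^ 2 - 1) * deriv f z = 2 * (α : ℂ) * f z)
    (hf_inf : Tendsto f (cobounded ℂ) (𝓝 1))
    (P0 P1 P2 p1 p2 : ℂ[X]) (c1 c2 : ℂ)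
    (h1 : P1 = C c1 + (derivative ((X ^ 2 - 1) * p1) + C (2 * (α : ℂ)) * p1))
    (h2 : P2 = C c2 + (derivative ((X ^ 2 - 1) * p2) + C (2 * ((2 * α : ℝ) : ℂ)) * p2))
    (hlim : Tendsto (fun z : ℂ => z * (P0.eval z + P1.eval z * f z + P2.eval z * f z ^ 2))
      (cobounded ℂ) (𝓝 0)) : c1 + 2 * c2 = 0 := by
  have hopen : IsOpen {z : ℂ | ¬(z.im = 0 ∧ |z.re| ≤ 1)} := by
    have : IsClosed {z : ℂ | z.im = 0 ∧ |z.re| ≤ 1} :=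
      (isClosed_eq Complex.continuous_im continuous_const).inter
        (isClosed_le Complex.continuous_re.abs continuous_const)
    exact this.isOpen_compl
  have hmem : ∀ z : ℂ, 1 < ‖z‖ → ¬(z.im = 0 ∧ |z.re| ≤ 1) := by
    rintro z hz ⟨hi, hr⟩
    have : z = (z.re : ℂ) := by apply Complex.ext <;> simp [hi]
    rw [this, Complex.norm_real, Real.norm_eq_abs] at hz
    linarith
  have hne : ∀ z : ℂ, 1 < ‖z‖ → z ^ 2 - 1 ≠ 0 := by
    intro z hz h
    have : ‖z‖ ^ 2 = 1 := by rw [← norm_pow, sub_eq_zero.1 h]; simp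
    nlinarith
  have hd : ∀ z : ℂ, 1 < ‖z‖ → HasDerivAt f (2 * (α : ℂ) * f z / (z ^ 2 - 1)) z := by
    intro z hz
    have h := (hf_dom.differentiableAt (hopen.mem_nhds (hmem z hz))).hasDerivAt
    refine h.congr_deriv ?_
    rw [eq_div_iff (hne z hz), mul_comm]
    exact hf_pearson z (hmem z hz)
  obtain ⟨c0, p0, h0⟩ := reduce 0 P0
  set g : ℂ → ℂ := fun z => (P0.eval z + P1.eval z * f z + P2.eval z * f z ^ 2) +
    (2 * α * c1 * (z * f z / (z ^ 2 - 1)) + 4 * α * c2 * (z * f z ^ 2 / (z ^ 2 - 1))) with hg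
  have hz2 : Tendsto (fun z : ℂ => z ^ 2 / (z ^ 2 - 1)) (cobounded ℂ) (𝓝 1) := by
    have hi : Tendsto (fun z : ℂ => (z⁻¹) ^ 2) (cobounded ℂ) (𝓝 0) := by
      simpa using (tendsto_inv₀_cobounded (α := ℂ)).pow 2
    have h3 : Tendsto (fun z : ℂ => (1 - (z⁻¹) ^ 2)⁻¹) (cobounded ℂ) (𝓝 1) := by
      have := (tendsto_const_nhds (x := (1 : ℂ)).sub hi).inv₀ (by simp)
      simpa using this
    refine h3.congr' ?_
    filter_upwards [(hasBasis_cobounded_norm (E := ℂ)).mem_of_mem (i := 2) trivial] with z hz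
    have hz : 2 ≤ ‖z‖ := hz
    have hz0 : z ≠ 0 := by rintro rfl; simp at hz; linarith
    have := hne z (by linarith)
    rw [eq_div_iff this, inv_mul_eq_iff_eq_mul₀]
    · field_simp
    · intro h
      apply this
      field_simp at h
      simpa using h
  have hL : Tendsto (fun z => z * g z) (cobounded ℂ) (𝓝 (2 * α * c1 + 4 * α * c2)) := by
    have a1 := (hz2.mul hf_inf).const_mul (2 * (α : ℂ) * c1)
    have a2 := (hz2.mul (hf_inf.pow 2)).const_mul (4 * (α : ℂ) * c2)
    have a := hlim.add (a1.add a2)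
    simp only [one_pow, mul_one, zero_add] at a
    refine a.congr ?_
    intro z
    simp only [hg]
    ring
  have hres := circ g _ ?_ ?_ hL
  · have hαC : (α : ℂ) ≠ 0 := by exact_mod_cast hα0
    have : 2 * (α : ℂ) * (c1 + 2 * c2) = 0 := by linear_combination hres
    simpa [hαC] using this
  · intro R hR z hz
    have hz' : 1 < ‖z‖ := by
      have : ‖z‖ = R := by simpa using hz
      linarith
    have hfc := (hd z hz').continuousAt
    have hzne := hne z hz'
    apply ContinuousAt.continuousWithinAt
    have b0 := P0.continuous.continuousAt (x := z)
    have b1 := P1.continuous.continuousAt (x := z)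
    have b2 := P2.continuous.continuousAt (x := z)
    simp only [hg]
    fun_prop (disch := assumption)
  · intro R hR
    refine circleIntegral.integral_eq_zero_of_hasDerivWithinAt (f := fun z =>
      (C c0 * X + (X ^ 2 - 1) * p0).eval z + (C c1 * X + (X ^ 2 - 1) * p1).eval z * f z
        + (C c2 * X + (X ^ 2 - 1) * p2).eval z * f z ^ 2) (by linarith) ?_
    intro z hz
    have hz' : 1 < ‖z‖ := by
      have : ‖z‖ = R := by simpa using hz
      linarith
    have hzne := hne z hz'
    have d := ((((C c0 * X + (X ^ 2 - 1) * p0).hasDerivAt z).add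
      (((C c1 * X + (X ^ 2 - 1) * p1).hasDerivAt z).mul (hd z hz'))).add
      (((C c2 * X + (X ^ 2 - 1) * p2).hasDerivAt z).mul ((hd z hz').pow 2)))
    refine (d.congr_deriv ?_).hasDerivWithinAt
    simp only [hg]
    rw [h0, h1, h2]
    simp
    field_simp
    ring

theorem stmt_14 (α : ℝ) (hα0 : 0 < |α|) (hα2 : |α| < 1 / 2)
    (f : ℂ → ℂ)
    (hf_dom : DifferentiableOn ℂ f {z : ℂ | ¬(z.im = 0 ∧ |z.re| ≤ 1)})
    (hf_pearson : ∀ z ∈ {z : ℂ | ¬(z.im = 0 ∧ |z.re| ≤ 1)},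
      (z ^ 2 - 1) * deriv f z = 2 * (α : ℂ) * f z)
    (hf_inf : Tendsto f (cobounded ℂ) (𝓝 1))
    (n : ℕ) (Q : Fin 3 → Polynomial ℂ)
    (hQ : ∃ k, Q k ≠ 0)
    (hdeg : ∀ k, (Q k).natDegree ≤ n)
    (hHP : (fun z : ℂ => (Q 0).eval z + (Q 1).eval z * f z + (Q 2).eval z * f z ^ 2)
      =O[cobounded ℂ] fun z => (z ^ (2 * n + 2))⁻¹) :
    ∀ q : Polynomial ℂ, q.natDegree ≤ 2 * n →
      ∫ x in Set.Ioo (-1 : ℝ) 1,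
        (((Q 1).eval (x : ℂ)
            + ((2 * Real.cos (α * Real.pi) : ℝ) : ℂ) * (Q 2).eval (x : ℂ)
              * ((((1 - x) / (1 + x)) ^ α : ℝ) : ℂ))
          * q.eval (x : ℂ) * ((((1 - x) / (1 + x)) ^ α : ℝ) : ℂ)) = 0 := by
  intro q hq
  have hα : α ≠ 0 := abs_pos.1 hα0
  have hα1 : |α| < 1 := by linarith
  have h2α : 2 * α ≠ 0 := by simpa using hα
  have h2α1 : |2 * α| < 1 := by rw [abs_mul, abs_two]; linarith
  obtain ⟨c1, p1, h1⟩ := reduce (α : ℂ) (Q 1 * q)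
  obtain ⟨c2, p2, h2⟩ := reduce ((2 * α : ℝ) : ℂ) (Q 2 * q)
  have hne0 : ∀ᶠ z : ℂ in cobounded ℂ, z ≠ 0 := by
    filter_upwards [(hasBasis_cobounded_norm (E := ℂ)).mem_of_mem (i := 1) trivial] with z hz
    rintro rfl
    simp at hz
    linarith
  have hlim : Tendsto (fun z : ℂ => z * ((Q 0 * q).eval z + (Q 1 * q).eval z * f z
      + (Q 2 * q).eval z * f z ^ 2)) (cobounded ℂ) (𝓝 0) := by
    have hqO : (fun z : ℂ => q.eval z) =O[cobounded ℂ] fun z => z ^ (2 * n) := by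
      have := isBigO_cobounded_of_degree_le (R := ℂ) (P := q) (Q := X ^ (2 * n))
        (by rw [degree_X_pow]; exact degree_le_of_natDegree_le hq)
      simpa using this
    have hO := (isBigO_refl (fun z : ℂ => z) (cobounded ℂ)).mul (hHP.mul hqO)
    have hO2 : (fun z : ℂ => z * ((Q 0 * q).eval z + (Q 1 * q).eval z * f z
      + (Q 2 * q).eval z * f z ^ 2)) =O[cobounded ℂ] fun z => z⁻¹ := by
      refine (hO.congr_left ?_).congr' (EventuallyEq.refl _ _) ?_
      · intro z
        simp only [eval_mul]
        ring
      · filter_upwards [hne0] with z hz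
        field_simp
        ring
    exact hO2.trans_tendsto tendsto_inv₀_cobounded
  have hrel := coef_rel α hα f hf_dom hf_pearson hf_inf (Q 0 * q) (Q 1 * q) (Q 2 * q) p1 p2 c1 c2
    h1 h2 hlim
  have i1 := full_int α hα hα1 c1 p1
  have i2 := full_int (2 * α) h2α h2α1 c2 p2
  rw [← h1] at i1
  rw [← h2] at i2
  have I1 := (beta_eq α hα hα1).1.continuousOn_mul (f := fun x : ℝ => ((wt α x : ℝ) : ℂ))
    ((Q 1 * q).continuous.comp Complex.continuous_ofReal).continuousOn
  have I2 := (beta_eq (2 * α) h2α h2α1).1.continuousOn_mul (f := fun x : ℝ => ((wt (2 * α) x : ℝ) : ℂ))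
    ((Q 2 * q).continuous.comp Complex.continuous_ofReal).continuousOn
  simp only [Function.comp_apply] at I1 I2
  have hs : Complex.sin (Real.pi * α) ≠ 0 := by
    rw [← Complex.ofReal_mul, ← Complex.ofReal_sin, Complex.ofReal_ne_zero]
    intro h
    obtain ⟨ha, hb⟩ := abs_lt.1 hα1
    have hp := Real.pi_pos
    rw [Real.sin_eq_zero_iff_of_lt_of_lt (by nlinarith) (by nlinarith)] at h
    simp [hα, hp.ne'] at h
  have hcos : Complex.cos (Real.pi * α) ≠ 0 := by
    rw [← Complex.ofReal_mul, ← Complex.ofReal_cos, Complex.ofReal_ne_zero]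
    obtain ⟨ha, hb⟩ := abs_lt.1 hα2
    have hp := Real.pi_pos
    exact (Real.cos_pos_of_mem_Ioo ⟨by nlinarith, by nlinarith⟩).ne'
  set k : ℂ := ((2 * Real.cos (α * Real.pi) : ℝ) : ℂ) with hk
  have hk' : k = 2 * Complex.cos (Real.pi * α) := by
    rw [hk]; push_cast; rw [mul_comm (α : ℂ)]
  have e : ∫ x in (-1 : ℝ)..1, ((Q 1 * q).eval (x : ℂ) * ((wt α x : ℝ) : ℂ) +
      k * ((Q 2 * q).eval (x : ℂ) * ((wt (2 * α) x : ℝ) : ℂ))) = 0 := by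
    rw [intervalIntegral.integral_add I1 (I2.const_mul k), intervalIntegral.integral_const_mul,
      i1, i2, hk']
    push_cast
    rw [show (Real.pi : ℂ) * (2 * α) = 2 * (Real.pi * α) by ring, Complex.sin_two_mul]
    generalize Complex.sin (Real.pi * α) = S at hs ⊢
    generalize Complex.cos (Real.pi * α) = K at hcos ⊢
    field_simp
    linear_combination (2 * (α : ℂ) * Real.pi) * hrel
  rw [intervalIntegral.integral_of_le (by norm_num), integral_Ioc_eq_integral_Ioo] at e
  rw [← e]
  refine setIntegral_congr_fun measurableSet_Ioo ?_
  intro x hx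
  have hx1 : 0 < 1 - x := by linarith [hx.2]
  have hx2 : 0 < 1 + x := by linarith [hx.1]
  have hw : wt (2 * α) x = wt α x * wt α x := by
    unfold wt
    rw [two_mul, Real.rpow_add (by positivity)]
  have hw1 : ((1 - x) / (1 + x)) ^ α = wt α x := rfl
  simp only [hw1, hw, eval_mul]
  push_cast
  ring
end

section
/- Let α ∈ ℝ with |α| ∈ (0,1/2), and let f(z) = ((z−1)/(z+1))^α be the holomorphic branch on ℂ∖[−1,1] with f(∞) = 1. Suppose P_{n,0}, P_{n,1} are polynomials of degree ≤ n, P_{n,1} not identically zero, such that P_{n,0}(z) + P_{n,1}(z) f(z) = O(z^{−(n+1)}) as z → ∞. Then P_{n,1} is orthogonal to all polynomials of degree ≤ n−1 with respect to the Jacobi-type weight ((1−x)/(1+x))^α on (−1,1): ∫_{−1}^{1} P_{n,1}(x) p(x) ((1−x)/(1+x))^α dx = 0 for every polynomial p of degree ≤ n−1. -/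
open Polynomial Filter Asymptotics Bornology Topology MeasureTheory

lemma func_zero (α : ℝ) (N : ℂ[X] →ₗ[ℂ] ℂ)
    (hT : ∀ p, N (derivative ((X^2 - 1) * p) + C (2 * (α:ℂ)) * p) = 0) (h1 : N 1 = 0) :
    ∀ p, N p = 0 := by
  have hX : ∀ k : ℕ, N (X^k) = 0 := by
    intro k
    induction k using Nat.strong_induction_on with
    | _ k ih =>
      rcases k with _ | k
      · simpa using h1
      · have h := hT (X^k)
        have C2 : (C (2:ℂ)) = (2 : ℂ[X]) := rfl
        have e : derivative ((X^2 - 1) * X^k) + C (2 * (α:ℂ)) * X^k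
          = ((k:ℂ) + 2) • (X:ℂ[X])^(k+1) - (k:ℂ) • (X:ℂ[X])^(k-1) + (2 * (α:ℂ)) • (X:ℂ[X])^k := by
          rcases k with _ | k
          · simp [smul_eq_C_mul, C2]; ring
          · simp [smul_eq_C_mul, C2]; ring
        rw [e, map_add, map_sub, map_smul, map_smul, map_smul, ih k (by omega),
          ih (k-1) (by omega)] at h
        have : ((k:ℂ) + 2) ≠ 0 := by exact_mod_cast (by omega : k + 2 ≠ 0)
        simpa [this] using h
  intro p
  rw [p.as_sum_range_C_mul_X_pow, map_sum]
  refine Finset.sum_eq_zero fun i _ => ?_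
  rw [← smul_eq_C_mul, map_smul, hX, smul_zero]

lemma circ_lim (h : ℂ → ℂ) (c : ℂ) (hd : ∀ z : ℂ, 1 < ‖z‖ → DifferentiableAt ℂ h z)
    (hl : Tendsto (fun z => z * h z) (cobounded ℂ) (𝓝 c)) :
    (∮ z in C(0, 2), h z) = 2 * Real.pi * Complex.I * c := by
  have key : ∀ ε > 0, ‖(∮ z in C(0, 2), h z) - 2 * Real.pi * Complex.I * c‖ ≤ 2 * Real.pi * ε := by
    intro ε hε
    have h1 : ∀ᶠ z in cobounded ℂ, ‖z * h z - c‖ < ε := by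
      have := (Metric.tendsto_nhds.1 hl) ε hε
      simpa [dist_eq_norm] using this
    obtain ⟨r, -, hr⟩ := (Metric.hasBasis_cobounded_compl_ball (0:ℂ)).eventually_iff.1 h1
    set R := max r 2
    have hR2 : (2:ℝ) ≤ R := le_max_right _ _
    have hR0 : (0:ℝ) < R := by linarith
    have eR : (∮ z in C(0, R), h z) = ∮ z in C(0, 2), h z := by
      refine Complex.circleIntegral_eq_of_differentiable_on_annulus_off_countable (by norm_num) hR2
        Set.countable_empty ?_ ?_
      · intro z hz
        refine (hd z ?_).continuousAt.continuousWithinAt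
        have := hz.2
        simp at this
        linarith
      · intro z hz
        refine hd z ?_
        have := hz.1.2
        simp at this
        linarith
    have hi : CircleIntegrable h 0 R := by
      refine ContinuousOn.circleIntegrable hR0.le fun z hz => ?_
      refine (hd z ?_).continuousAt.continuousWithinAt
      have : ‖z‖ = R := by simpa using hz
      linarith
    have hi2 : CircleIntegrable (fun z : ℂ => c * (z - 0)⁻¹) 0 R := by
      refine ContinuousOn.circleIntegrable hR0.le fun z hz => ?_
      have : ‖z‖ = R := by simpa using hz
      have hz0 : z - 0 ≠ 0 := by
        rw [sub_zero, ← norm_pos_iff]; linarith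
      exact (ContinuousAt.mul continuousAt_const
        ((continuousAt_id.sub continuousAt_const).inv₀ hz0)).continuousWithinAt
    have e2 : (∮ z in C(0, R), c * (z - 0)⁻¹) = 2 * Real.pi * Complex.I * c := by
      rw [circleIntegral.integral_const_mul, circleIntegral.integral_sub_center_inv _ hR0.ne']
      ring
    rw [← eR, ← e2, ← circleIntegral.integral_sub hi hi2]
    have := circleIntegral.norm_integral_le_of_norm_le_const (f := fun z => h z - c * (z - 0)⁻¹)
      (c := 0) (C := ε / R) hR0.le ?_
    · refine this.trans (le_of_eq ?_)
      field_simp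
    · intro z hz
      have hn : ‖z‖ = R := by simpa using hz
      have hz0 : z ≠ 0 := by rw [← norm_pos_iff]; linarith
      have hb := hr (x := z) (by simp [hn, R])
      have : h z - c * (z - 0)⁻¹ = (z * h z - c) * z⁻¹ := by
        field_simp; simp
      rw [this, norm_mul, norm_inv, hn, div_eq_mul_inv]
      gcongr
  have h0 : ‖(∮ z in C(0, 2), h z) - 2 * Real.pi * Complex.I * c‖ ≤ 0 := by
    refine le_of_forall_pos_le_add fun ε hε => ?_
    have := key (ε / (2 * Real.pi)) (by positivity)
    refine this.trans (le_of_eq ?_)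
    field_simp
    simp
  exact sub_eq_zero.1 (norm_le_zero_iff.1 h0)

lemma w_eq (α x : ℝ) (hx : x ∈ Set.Ioo (-1:ℝ) 1) :
    ((1 - x) / (1 + x)) ^ α = (1 - x) ^ α * (1 + x) ^ (-α) := by
  have h1 : 0 < 1 - x := by linarith [hx.2]
  have h2 : 0 < 1 + x := by linarith [hx.1]
  rw [Real.div_rpow h1.le h2.le, Real.rpow_neg h2.le, div_eq_mul_inv]

lemma w_int (α : ℝ) (hα2 : |α| < 1 / 2) :
    IntervalIntegrable (fun x : ℝ => ((1 - x) / (1 + x)) ^ α) volume (-1) 1 := by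
  have ⟨ha, hb⟩ := abs_lt.1 hα2
  have i1 : IntervalIntegrable (fun x : ℝ => (1 - x) ^ (2 * α)) volume (-1) 1 := by
    have := (intervalIntegral.intervalIntegrable_rpow' (a := 2) (b := 0) (r := 2 * α)
      (by linarith)).comp_sub_left 1
    norm_num at this
    exact this
  have i2 : IntervalIntegrable (fun x : ℝ => (1 + x) ^ (2 * (-α))) volume (-1) 1 := by
    have := (intervalIntegral.intervalIntegrable_rpow' (a := 0) (b := 2) (r := 2 * (-α))
      (by linarith)).comp_add_left 1
    norm_num at this ⊢
    exact this
  have i3 := i1.add i2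
  rw [intervalIntegrable_iff_integrableOn_Ioo_of_le (by norm_num)] at i3 ⊢
  refine Integrable.mono' i3 (Measurable.aestronglyMeasurable (by measurability)) ?_
  rw [ae_restrict_iff' measurableSet_Ioo]
  refine Eventually.of_forall fun x hx => ?_
  have h1 : 0 < 1 - x := by linarith [hx.2]
  have h2 : 0 < 1 + x := by linarith [hx.1]
  rw [Real.norm_of_nonneg (by positivity), w_eq α x hx]
  rw [mul_comm 2 α, mul_comm 2 (-α), Real.rpow_mul h1.le, Real.rpow_mul h2.le, Real.rpow_two,
    Real.rpow_two]
  nlinarith [sq_nonneg ((1 - x) ^ α - (1 + x) ^ (-α)), sq_nonneg ((1 - x) ^ α),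
    sq_nonneg ((1 + x) ^ (-α))]

lemma pw_int (α : ℝ) (hα2 : |α| < 1 / 2) (p : ℂ[X]) :
    IntervalIntegrable (fun x : ℝ => p.eval (x:ℂ) * ((((1 - x) / (1 + x)) ^ α : ℝ) : ℂ))
      volume (-1) 1 := by
  have h : IntervalIntegrable (fun x : ℝ => ((((1 - x) / (1 + x)) ^ α : ℝ) : ℂ))
      volume (-1) 1 := ⟨(w_int α hα2).1.ofReal, (w_int α hα2).2.ofReal⟩
  refine IntervalIntegrable.continuousOn_mul h ?_
  exact (p.continuous.comp Complex.continuous_ofReal).continuousOn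

lemma w_parts (α : ℝ) (hα2 : |α| < 1 / 2) (p : ℂ[X]) :
    ∫ x in (-1:ℝ)..1, ((derivative ((X^2 - 1) * p) + C (2 * (α:ℂ)) * p).eval (x:ℂ)
      * ((((1 - x) / (1 + x)) ^ α : ℝ) : ℂ)) = 0 := by
  have ⟨ha, hb⟩ := abs_lt.1 hα2
  rw [intervalIntegral.integral_eq_sub_of_hasDerivAt_of_le
    (f := fun x : ℝ => - (p.eval (x:ℂ)) * (((1 - x) ^ (1 + α) * (1 + x) ^ (1 - α) : ℝ) : ℂ))
    (by norm_num) _ _ (pw_int α hα2 _)]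
  · have h1 : (1 + α) ≠ 0 := by linarith
    have h2 : (1 - α) ≠ 0 := by linarith
    simp [Real.zero_rpow h1, Real.zero_rpow h2]
  · refine Continuous.continuousOn ?_
    refine ((p.continuous.comp Complex.continuous_ofReal).neg).mul
      (Complex.continuous_ofReal.comp ?_)
    exact ((continuous_const.sub continuous_id).rpow_const (fun x => Or.inr (by linarith))).mul
      ((continuous_const.add continuous_id).rpow_const (fun x => Or.inr (by linarith)))
  · intro x hx
    have h1 : 0 < 1 - x := by linarith [hx.2]
    have h2 : 0 < 1 + x := by linarith [hx.1]
    have d1 : HasDerivAt (fun x : ℝ => (1 - x) ^ (1 + α)) (-1 * (1 + α) * (1 - x) ^ (1 + α - 1)) x :=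
      ((hasDerivAt_id x).const_sub 1).rpow_const (Or.inl h1.ne')
    have d2 : HasDerivAt (fun x : ℝ => (1 + x) ^ (1 - α)) (1 * (1 - α) * (1 + x) ^ (1 - α - 1)) x :=
      ((hasDerivAt_id x).const_add 1).rpow_const (Or.inl h2.ne')
    have d3 := (d1.mul d2).ofReal_comp
    have d4 : HasDerivAt (fun x : ℝ => p.eval (x:ℂ)) ((derivative p).eval (x:ℂ)) x :=
      (p.hasDerivAt (x:ℂ)).comp_ofReal
    refine (d4.neg.mul d3).congr_deriv ?_
    have e1 : (1 - x) ^ (1 + α) = (1 - x) * (1 - x) ^ α := by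
      rw [Real.rpow_add h1, Real.rpow_one]
    have e2 : (1 + x) ^ (1 - α) = (1 + x) * (1 + x) ^ (-α) := by
      rw [sub_eq_add_neg, Real.rpow_add h2, Real.rpow_one]
    simp only [Pi.mul_apply, Pi.neg_apply, w_eq α x hx, e1, e2, show 1 + α - 1 = α by ring,
      show 1 - α - 1 = -α by ring]
    simp
    ring

lemma mem_D {z : ℂ} (hz : 1 < ‖z‖) : z ∈ {z : ℂ | ¬(z.im = 0 ∧ |z.re| ≤ 1)} := by
  rintro ⟨h1, h2⟩
  have := Complex.norm_le_abs_re_add_abs_im z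
  rw [h1, abs_zero] at this
  linarith

lemma isOpen_D : IsOpen {z : ℂ | ¬(z.im = 0 ∧ |z.re| ≤ 1)} := by
  have : IsClosed {z : ℂ | z.im = 0 ∧ |z.re| ≤ 1} :=
    (isClosed_eq Complex.continuous_im continuous_const).inter
      (isClosed_le Complex.continuous_re.abs continuous_const)
  exact this.isOpen_compl

lemma circ_parts (α : ℝ) (f : ℂ → ℂ) (hd : ∀ z : ℂ, 1 < ‖z‖ → DifferentiableAt ℂ f z)
    (hp : ∀ z : ℂ, 1 < ‖z‖ → (z ^ 2 - 1) * deriv f z = 2 * (α : ℂ) * f z) (p : ℂ[X]) :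
    (∮ z in C(0, 2), (derivative ((X^2 - 1) * p) + C (2 * (α:ℂ)) * p).eval z * f z) = 0 := by
  refine circleIntegral.integral_eq_zero_of_hasDerivWithinAt
    (f := fun z => ((X^2 - 1) * p).eval z * f z) (by norm_num) fun z hz => ?_
  have hn : 1 < ‖z‖ := by
    have : ‖z‖ = 2 := by simpa using hz
    linarith
  refine HasDerivAt.hasDerivWithinAt ?_
  refine ((((X^2 - 1) * p).hasDerivAt z).mul (hd z hn).hasDerivAt).congr_deriv ?_
  have := hp z hn
  simp only [eval_add, eval_mul, eval_C, eval_sub, eval_pow, eval_X, eval_one]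
  linear_combination (eval z p) * this

lemma circ_M0 (α : ℝ) (f : ℂ → ℂ) (hd : ∀ z : ℂ, 1 < ‖z‖ → DifferentiableAt ℂ f z)
    (hp : ∀ z : ℂ, 1 < ‖z‖ → (z ^ 2 - 1) * deriv f z = 2 * (α : ℂ) * f z)
    (hf_inf : Tendsto f (cobounded ℂ) (𝓝 1)) :
    (∮ z in C(0, 2), f z) = - (2 * Real.pi * Complex.I * (2 * α)) := by
  set g : ℂ → ℂ := fun z => (z⁻¹ * z⁻¹ + 2 * α * z⁻¹) * f z with hg
  have hgd : ∀ z : ℂ, 1 < ‖z‖ → DifferentiableAt ℂ g z := by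
    intro z hz
    have hz0 : z ≠ 0 := by rw [← norm_pos_iff]; linarith
    have := hd z hz
    fun_prop (disch := assumption)
  have hinv : Tendsto (fun z : ℂ => z⁻¹) (cobounded ℂ) (𝓝 0) := tendsto_inv₀_cobounded
  have hgi : (∮ z in C(0, 2), g z) = 2 * Real.pi * Complex.I * (2 * α) := by
    refine circ_lim g _ hgd ?_
    have h1 : Tendsto (fun z : ℂ => (z⁻¹ + 2 * α) * f z) (cobounded ℂ) (𝓝 ((0 + 2 * α) * 1)) :=
      (hinv.add tendsto_const_nhds).mul hf_inf
    rw [zero_add, mul_one] at h1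
    refine h1.congr' ?_
    filter_upwards [eventually_ne_cobounded (0:ℂ)] with z hz
    simp only [hg]
    field_simp
  have hs : (∮ z in C(0, 2), (f z + g z)) = 0 := by
    refine circleIntegral.integral_eq_zero_of_hasDerivWithinAt
      (f := fun z => (z - z⁻¹) * f z) (by norm_num) fun z hz => ?_
    have hn : 1 < ‖z‖ := by
      have : ‖z‖ = 2 := by simpa using hz
      linarith
    have hz0 : z ≠ 0 := by rw [← norm_pos_iff]; linarith
    refine HasDerivAt.hasDerivWithinAt ?_
    refine (((hasDerivAt_id z).sub (hasDerivAt_inv hz0)).mul (hd z hn).hasDerivAt).congr_deriv ?_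
    have := hp z hn
    have e : deriv f z * (z - z⁻¹) = z⁻¹ * (2 * α * f z) := by
      rw [← this]; field_simp
    simp only [hg, Pi.sub_apply, id]
    have e2 : (z^2)⁻¹ = z⁻¹ * z⁻¹ := by rw [pow_two, mul_inv]
    rw [e2]
    linear_combination e
  have ci : ∀ h : ℂ → ℂ, (∀ z : ℂ, 1 < ‖z‖ → DifferentiableAt ℂ h z) → CircleIntegrable h 0 2 := by
    intro h hh
    refine ContinuousOn.circleIntegrable (by norm_num) fun z hz => ?_
    refine (hh z ?_).continuousAt.continuousWithinAt
    have : ‖z‖ = 2 := by simpa using hz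
    linarith
  rw [circleIntegral.integral_add (ci f hd) (ci g hgd), hgi] at hs
  exact eq_neg_of_add_eq_zero_left hs

lemma poly_isBigO (n : ℕ) (q : ℂ[X]) (hq : q.degree < (n : WithBot ℕ)) :
    (fun z : ℂ => z * q.eval z) =O[cobounded ℂ] fun z => z ^ n := by
  have : (fun z : ℂ => z * q.eval z) = fun z => ∑ i ∈ Finset.range n, q.coeff i * z ^ (i + 1) := by
    funext z
    by_cases h : q = 0
    · simp [h]
    · rw [eval_eq_sum_range' ((natDegree_lt_iff_degree_lt h).2 hq), Finset.mul_sum]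
      refine Finset.sum_congr rfl fun i _ => ?_
      ring
  rw [this]
  refine IsBigO.fun_sum fun i hi => ?_
  refine IsBigO.const_mul_left ?_ _
  refine IsBigO.of_bound 1 ?_
  filter_upwards [(tendsto_norm_cobounded_atTop (E := ℂ)).eventually_ge_atTop 1] with z hz
  rw [norm_pow, norm_pow, one_mul]
  exact pow_le_pow_right₀ hz (Finset.mem_range.1 hi)

set_option maxHeartbeats 1000000 in
theorem stmt_15 (α : ℝ) (hα0 : 0 < |α|) (hα2 : |α| < 1 / 2)
    (f : ℂ → ℂ)
    (hf_dom : DifferentiableOn ℂ f {z : ℂ | ¬(z.im = 0 ∧ |z.re| ≤ 1)})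
    (hf_pearson : ∀ z ∈ {z : ℂ | ¬(z.im = 0 ∧ |z.re| ≤ 1)},
      (z ^ 2 - 1) * deriv f z = 2 * (α : ℂ) * f z)
    (hf_inf : Tendsto f (cobounded ℂ) (𝓝 1))
    (n : ℕ) (P₀ P₁ : Polynomial ℂ) (hP₁ : P₁ ≠ 0)
    (hdeg₀ : P₀.natDegree ≤ n) (hdeg₁ : P₁.natDegree ≤ n)
    (hPade : (fun z : ℂ => P₀.eval z + P₁.eval z * f z)
      =O[cobounded ℂ] fun z => (z ^ (n + 1))⁻¹) :
    ∀ q : Polynomial ℂ, q.degree < (n : WithBot ℕ) →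
      ∫ x in Set.Ioo (-1 : ℝ) 1,
        (P₁.eval (x : ℂ) * q.eval (x : ℂ) * ((((1 - x) / (1 + x)) ^ α : ℝ) : ℂ)) = 0 := by
  intro q hq
  have hd : ∀ z : ℂ, 1 < ‖z‖ → DifferentiableAt ℂ f z := fun z hz =>
    (hf_dom z (mem_D hz)).differentiableAt (isOpen_D.mem_nhds (mem_D hz))
  have hp : ∀ z : ℂ, 1 < ‖z‖ → (z ^ 2 - 1) * deriv f z = 2 * (α : ℂ) * f z := fun z hz =>
    hf_pearson z (mem_D hz)
  have ci : ∀ h : ℂ → ℂ, (∀ z : ℂ, 1 < ‖z‖ → DifferentiableAt ℂ h z) → CircleIntegrable h 0 2 := by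
    intro h hh
    refine ContinuousOn.circleIntegrable (by norm_num) fun z hz => ?_
    refine (hh z ?_).continuousAt.continuousWithinAt
    have : ‖z‖ = 2 := by simpa using hz
    linarith
  have pd : ∀ p : ℂ[X], ∀ z : ℂ, 1 < ‖z‖ → DifferentiableAt ℂ (fun z => p.eval z * f z) z :=
    fun p z hz => p.differentiable.differentiableAt.mul (hd z hz)
  let M : ℂ[X] →ₗ[ℂ] ℂ :=
    { toFun := fun p => ∮ z in C(0, 2), p.eval z * f z
      map_add' := fun p r => by
        rw [← circleIntegral.integral_add (ci _ (pd p)) (ci _ (pd r))]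
        simp only [eval_add, add_mul]
      map_smul' := fun c p => by
        simp only [eval_smul, smul_eq_mul, mul_assoc, RingHom.id_apply]
        rw [circleIntegral.integral_const_mul] }
  let L : ℂ[X] →ₗ[ℂ] ℂ :=
    { toFun := fun p => ∫ x in (-1:ℝ)..1, (p.eval (x:ℂ) * ((((1 - x) / (1 + x)) ^ α : ℝ) : ℂ))
      map_add' := fun p r => by
        rw [← intervalIntegral.integral_add (pw_int α hα2 p) (pw_int α hα2 r)]
        simp only [eval_add, add_mul]
      map_smul' := fun c p => by
        simp only [eval_smul, smul_eq_mul, mul_assoc, RingHom.id_apply]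
        rw [intervalIntegral.integral_const_mul] }
  have hLT : ∀ p, L (derivative ((X^2 - 1) * p) + C (2 * (α:ℂ)) * p) = 0 := w_parts α hα2
  have hMT : ∀ p, M (derivative ((X^2 - 1) * p) + C (2 * (α:ℂ)) * p) = 0 :=
    circ_parts α f hd hp
  have hN := func_zero α (L 1 • M - M 1 • L) (fun p => by
    rw [LinearMap.sub_apply, LinearMap.smul_apply, LinearMap.smul_apply, hLT, hMT, smul_zero, smul_zero, sub_zero])
    (sub_eq_zero.2 (mul_comm (L 1) (M 1))) (P₁ * q)
  have hM1 : M 1 ≠ 0 := by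
    have : M 1 = - (2 * Real.pi * Complex.I * (2 * α)) := by
      rw [← circ_M0 α f hd hp hf_inf]
      simp [M]
    rw [this]
    have h0 : α ≠ 0 := abs_pos.1 hα0
    simp [h0, Real.pi_ne_zero]
  have hMq : M (P₁ * q) = 0 := by
    have h1 : (∮ z in C(0, 2), (P₀.eval z + P₁.eval z * f z) * q.eval z)
        = 2 * Real.pi * Complex.I * 0 := by
      refine circ_lim _ 0 (fun z hz => ?_) ?_
      · exact (P₀.differentiable.differentiableAt.add (pd P₁ z hz)).mul
          q.differentiable.differentiableAt
      · have h2 := hPade.mul (poly_isBigO n q hq)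
        have h3 : Tendsto (fun z : ℂ => (z ^ (n + 1))⁻¹ * z ^ n) (cobounded ℂ) (𝓝 0) := by
          refine (tendsto_inv₀_cobounded (α := ℂ)).congr' ?_
          filter_upwards [eventually_ne_cobounded (0:ℂ)] with z hz
          field_simp
          ring
        refine (h2.trans_tendsto h3).congr fun z => ?_
        ring
    have h4 : (∮ z in C(0, 2), (P₀ * q).eval z) = 0 :=
      Complex.circleIntegral_eq_zero_of_differentiable_on_off_countable (by norm_num)
        Set.countable_empty (P₀ * q).continuous.continuousOn
        (fun z _ => (P₀ * q).differentiable.differentiableAt)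
    have h5 : M (P₁ * q) = ∮ z in C(0, 2), (P₁ * q).eval z * f z := rfl
    rw [h5]
    have h6 := circleIntegral.integral_add
      (ci _ fun z _ => (P₀ * q).differentiable.differentiableAt) (ci _ (pd (P₁ * q)))
    rw [h4, zero_add] at h6
    refine h6.symm.trans (Eq.trans ?_ (h1.trans (mul_zero _)))
    refine circleIntegral.integral_congr zero_le_two fun z _ => ?_
    simp only [eval_mul]
    ring
  rw [LinearMap.sub_apply, LinearMap.smul_apply, LinearMap.smul_apply, hMq, smul_zero, zero_sub, neg_eq_zero, smul_eq_mul] at hN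
  have hL : L (P₁ * q) = 0 := (mul_eq_zero.1 hN).resolve_left hM1
  rw [← integral_Ioc_eq_integral_Ioo, ← intervalIntegral.integral_of_le (by norm_num), ← hL]
  simp [L]
end

section
/- Let α ∈ ℝ with |α| ∈ (0,1/2), let f(z) = ((z−1)/(z+1))^α be the holomorphic branch on ℂ∖[−1,1] with f(∞) = 1, and for each n let Q_{n,0}, Q_{n,1}, Q_{n,2} be type I Hermite–Padé polynomials of order n for (1, f, f²), each n being a normal index; all zeros of Q_{n,0} are real and lie outside [−1,1], so h_n(z) = Q_{n,0}'(z)/(n Q_{n,0}(z)) is holomorphic on ℂ∖ℝ. Suppose Λ ⊆ ℕ is infinite and h is a function on ℂ∖ℝ such that h_n → h locally uniformly on ℂ∖ℝ as n → ∞ along Λ. Then h satisfies the algebraic equation (z²−1)² h(z)³ − 3(z²−1) h(z) + 2z = 0 for every z ∈ ℂ∖ℝ. -/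
open Polynomial Filter Asymptotics Bornology Topology

lemma aux_zpow (s : ℤ) : ∃ B : ℝ, 0 < B ∧ ∀ t w : ℝ, 0 < t → t / 2 ≤ w → w ≤ 2 * t → w ^ s ≤ B * t ^ s := by
  obtain ⟨n, rfl | rfl⟩ := s.eq_nat_or_neg
  · refine ⟨2 ^ n, by positivity, fun t w ht h1 h2 => ?_⟩
    simp only [zpow_natCast]
    rw [← mul_pow]
    gcongr
    linarith
  · refine ⟨2 ^ n, by positivity, fun t w ht h1 h2 => ?_⟩
    simp only [zpow_neg, zpow_natCast]
    have : (2:ℝ) ^ n * (t ^ n)⁻¹ = ((t / 2) ^ n)⁻¹ := by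
      rw [div_pow, inv_div]; rfl
    rw [this]
    gcongr

lemma deriv_littleO (g : ℂ → ℂ) (s : ℤ) (hg : DifferentiableOn ℂ g {z : ℂ | 1 < ‖z‖})
    (ho : g =o[cobounded ℂ] fun z => z ^ s) :
    deriv g =o[cobounded ℂ] fun z => z ^ (s - 1) := by
  obtain ⟨B, hB, hb⟩ := aux_zpow s
  rw [isLittleO_iff] at ho ⊢
  intro c hc
  have h1 := ho (c := c / (2 * B)) (by positivity)
  rw [← comap_norm_atTop, eventually_comap, eventually_atTop] at h1
  obtain ⟨r, hr⟩ := h1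
  rw [← comap_norm_atTop, eventually_comap, eventually_atTop]
  refine ⟨max (2 * r) 3, ?_⟩
  rintro t ht z rfl
  have ht1 : 2 * r ≤ ‖z‖ := le_trans (le_max_left _ _) ht
  have ht2 : 3 ≤ ‖z‖ := le_trans (le_max_right _ _) ht
  have hsub : ∀ w ∈ Metric.closedBall z (‖z‖ / 2), ‖z‖ / 2 ≤ ‖w‖ ∧ ‖w‖ ≤ 2 * ‖z‖ := by
    intro w hw
    rw [Metric.mem_closedBall, dist_eq_norm] at hw
    have h3 := norm_sub_norm_le z w
    rw [norm_sub_rev] at h3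
    have h4 := norm_sub_norm_le w z
    constructor <;> linarith
  have key := Complex.norm_deriv_le_of_forall_mem_sphere_norm_le (c := z) (R := ‖z‖ / 2) (f := g)
    (C := c / (2 * B) * (B * ‖z‖ ^ s)) (by linarith) ?_ ?_
  · refine key.trans (le_of_eq ?_)
    have hz : ‖z‖ ≠ 0 := by linarith
    rw [norm_zpow, zpow_sub₀ hz]
    field_simp
    
  · refine (hg.mono ?_).diffContOnCl
    intro w hw
    have := (hsub w (Metric.closure_ball_subset_closedBall hw)).1
    show 1 < ‖w‖
    linarith
  · intro w hw
    have h5 := hsub w (Metric.sphere_subset_closedBall hw)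
    refine (hr ‖w‖ (by linarith) w rfl).trans ?_
    rw [norm_zpow]
    gcongr
    exact hb _ _ (by linarith) h5.1 h5.2

/-- multiplication rule -/
lemma lo_mul {g k : ℂ → ℂ} {a b : ℤ} (c : ℤ) (h1 : g =o[cobounded ℂ] fun z => z ^ a)
    (h2 : k =O[cobounded ℂ] fun z => z ^ b) (hc : a + b = c) :
    (fun z => g z * k z) =o[cobounded ℂ] fun z => z ^ c := by
  refine (h1.mul_isBigO h2).congr' (by rfl) ?_
  filter_upwards [eventually_ne_cobounded (0:ℂ)] with z hz
  rw [← zpow_add₀ hz, hc]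

lemma zpow_O {a b : ℤ} (h : a ≤ b) :
    (fun z : ℂ => z ^ a) =O[cobounded ℂ] fun z => z ^ b := by
  refine IsBigO.of_bound 1 ?_
  filter_upwards [eventually_cobounded_le_norm (1:ℝ)] with z hz
  rw [one_mul, norm_zpow, norm_zpow]
  exact zpow_le_zpow_right₀ hz h

lemma poly_O (p : ℂ[X]) (m : ℤ) (h : (p.natDegree : ℤ) ≤ m) :
    (fun z : ℂ => p.eval z) =O[cobounded ℂ] fun z => z ^ m := by
  simp only [eval_eq_sum_range]
  refine IsBigO.fun_sum (s := Finset.range (p.natDegree + 1)) fun i hi => ?_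
  refine IsBigO.const_mul_left ?_ _
  have := zpow_O (a := i) (b := m) (by have := Finset.mem_range.1 hi; omega)
  simpa using this

lemma theta_lo (g : ℂ → ℂ) (s : ℤ) (hg : DifferentiableOn ℂ g {z : ℂ | 1 < ‖z‖})
    (ho : g =o[cobounded ℂ] fun z => z ^ s) :
    (fun z => (z ^ 2 - 1) * deriv g z) =o[cobounded ℂ] fun z => z ^ (s + 1) := by
  have h1 := deriv_littleO g s hg ho
  have h2 := poly_O (X ^ 2 - 1) 2 (by
    have : (X ^ 2 - 1 : ℂ[X]).natDegree = 2 := by compute_degree!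
    rw [this]; rfl)
  refine (lo_mul (s + 1) h1 h2 (by ring)).congr' (Eventually.of_forall fun z => ?_) (by rfl)
  simp; ring

lemma poly_zero_of_lo (p : ℂ[X]) (h : (fun z : ℂ => p.eval z) =o[cobounded ℂ] fun z => z ^ (0:ℤ)) :
    p = 0 := by
  have h0 : Tendsto (fun z : ℂ => p.eval z) (cobounded ℂ) (𝓝 0) := by
    simp only [zpow_zero] at h
    exact (isLittleO_one_iff ℂ).1 h
  by_cases hd : 0 < p.degree
  · exfalso
    have := p.tendsto_norm_atTop hd tendsto_norm_cobounded_atTop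
    exact not_tendsto_nhds_of_tendsto_atTop this _ h0.norm
  · rw [not_lt] at hd
    rw [eq_C_of_degree_le_zero hd] at h0 ⊢
    simp only [eval_C] at h0
    rw [tendsto_nhds_unique tendsto_const_nhds h0, C_0]

/-- the shifted operator -/
noncomputable def tau (c : ℂ) (p : ℂ[X]) : ℂ[X] := (X ^ 2 - 1) * derivative p + C c * p

lemma tau_natDegree (c : ℂ) (p : ℂ[X]) (m : ℕ) (h : p.natDegree ≤ m) :
    (tau c p).natDegree ≤ m + 1 := by
  unfold tau
  refine natDegree_add_le_of_degree_le ?_ ?_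
  · by_cases hp : p.natDegree = 0
    · rw [derivative_of_natDegree_zero hp]; simp
    · have h2 : (X ^ 2 - 1 : ℂ[X]).natDegree ≤ 2 := by compute_degree!
      refine natDegree_mul_le.trans ?_
      have := natDegree_derivative_lt hp
      omega
  · refine (natDegree_C_mul_le _ _).trans (by omega)

lemma tau_local (c : ℂ) (s : ℂ[X]) (a : ℕ) :
    ∃ s' : ℂ[X], tau c ((X - C 1) ^ a * s) = (X - C 1) ^ a * s' ∧
      s'.eval 1 = (2 * a + c) * s.eval 1 := by
  refine ⟨(a : ℂ[X]) * (X + 1) * s + (X ^ 2 - 1) * derivative s + C c * s, ?_, ?_⟩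
  · unfold tau
    rcases a with _ | a
    · simp
    · simp only [derivative_mul, derivative_pow, derivative_sub, derivative_X, derivative_one, C_1]
      simp only [Nat.add_sub_cancel, map_natCast]
      push_cast
      ring
  · simp; ring

lemma loc_form (s : ℂ[X]) (hs : s ≠ 0) : ∃ (a : ℕ) (t : ℂ[X]), s = (X - C 1) ^ a * t ∧ t.eval 1 ≠ 0 := by
  obtain ⟨t, h1, h2⟩ := exists_eq_pow_rootMultiplicity_mul_and_not_dvd s hs 1
  exact ⟨_, t, h1, fun h => h2 (dvd_iff_isRoot.2 h)⟩

lemma det2 (c d : ℂ) (A B : ℂ[X]) (hcd : ∀ k : ℤ, d - c ≠ 2 * k)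
    (h : A * tau d B - tau c A * B = 0) : A = 0 ∨ B = 0 := by
  by_contra! hne
  obtain ⟨a, A0, hA, hA1⟩ := loc_form A hne.1
  obtain ⟨b, B0, hB, hB1⟩ := loc_form B hne.2
  obtain ⟨A1, hA2, hA3⟩ := tau_local c A0 a
  obtain ⟨B1, hB2, hB3⟩ := tau_local d B0 b
  rw [← hA] at hA2
  rw [← hB] at hB2
  rw [hA2, hB2, hA, hB] at h
  have h' : (X - C 1) ^ (a + b) * (A0 * B1 - A1 * B0) = 0 := by
    rw [← h]; ring
  have h2 := (mul_eq_zero.1 h').resolve_left (pow_ne_zero _ (X_sub_C_ne_zero 1))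
  have h3 := congrArg (eval 1) h2
  simp only [eval_sub, eval_mul, hA3, hB3, eval_zero] at h3
  have h4 : eval 1 A0 * eval 1 B0 * ((d - c) - 2 * ((a - b : ℤ) : ℂ)) = 0 := by
    push_cast; rw [← h3]; ring
  simp only [mul_eq_zero, hA1, hB1, false_or] at h4
  exact hcd _ (sub_eq_zero.1 h4)

lemma det3 (c d e : ℂ) (A B D : ℂ[X]) (hcd : ∀ k : ℤ, d - c ≠ 2 * k)
    (hce : ∀ k : ℤ, e - c ≠ 2 * k) (hde : ∀ k : ℤ, e - d ≠ 2 * k)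
    (h : A * (tau d B * tau e (tau e D) - tau d (tau d B) * tau e D)
      - tau c A * (B * tau e (tau e D) - tau d (tau d B) * D)
      + tau c (tau c A) * (B * tau e D - tau d B * D) = 0) : A = 0 ∨ B = 0 ∨ D = 0 := by
  by_contra! hne
  obtain ⟨a, A0, hA, hA1⟩ := loc_form A hne.1
  obtain ⟨b, B0, hB, hB1⟩ := loc_form B hne.2.1
  obtain ⟨k, D0, hD, hD1⟩ := loc_form D hne.2.2
  obtain ⟨A1, hA2, hA3⟩ := tau_local c A0 a
  obtain ⟨B1, hB2, hB3⟩ := tau_local d B0 b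
  obtain ⟨D1, hD2, hD3⟩ := tau_local e D0 k
  obtain ⟨A2, hA4, hA5⟩ := tau_local c A1 a
  obtain ⟨B2, hB4, hB5⟩ := tau_local d B1 b
  obtain ⟨D2, hD4, hD5⟩ := tau_local e D1 k
  rw [← hA] at hA2
  rw [← hB] at hB2
  rw [← hD] at hD2
  rw [hA2, hB2, hD2, hA4, hB4, hD4, hA, hB, hD] at h
  have h' : (X - C 1) ^ (a + b + k) * (A0 * (B1 * D2 - B2 * D1) - A1 * (B0 * D2 - B2 * D0)
     + A2 * (B0 * D1 - B1 * D0)) = 0 := by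
    rw [← h]; ring
  have h2 := (mul_eq_zero.1 h').resolve_left (pow_ne_zero _ (X_sub_C_ne_zero 1))
  have h3 := congrArg (eval 1) h2
  simp only [eval_sub, eval_add, eval_mul, hA3, hB3, hD3, hA5, hB5, hD5, eval_zero] at h3
  have h4 : eval 1 A0 * eval 1 B0 * eval 1 D0 * ((d - c) - 2 * ((a - b : ℤ) : ℂ)) *
     ((e - c) - 2 * ((a - k : ℤ) : ℂ)) * ((e - d) - 2 * ((b - k : ℤ) : ℂ)) = 0 := by
    push_cast; rw [← h3]; ring
  simp only [mul_eq_zero, hA1, hB1, hD1, false_or] at h4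
  rcases h4 with (h4 | h4) | h4
  · exact hcd _ (sub_eq_zero.1 h4)
  · exact hce _ (sub_eq_zero.1 h4)
  · exact hde _ (sub_eq_zero.1 h4)

noncomputable def FF (f : ℂ → ℂ) (A B D : ℂ[X]) (z : ℂ) : ℂ :=
  A.eval z + B.eval z * f z + D.eval z * f z ^ 2

lemma sq_sub_ne {z : ℂ} (hz : 1 < ‖z‖) : z ^ 2 - 1 ≠ 0 := by
  intro h
  have h1 : z ^ 2 = 1 := sub_eq_zero.1 h
  have h2 : ‖z‖ ^ 2 = 1 := by rw [← norm_pow, h1, norm_one]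
  nlinarith

lemma isOpen_U : IsOpen {z : ℂ | 1 < ‖z‖} := isOpen_lt continuous_const continuous_norm

section
variable {a : ℂ} {f : ℂ → ℂ} (hfd : DifferentiableOn ℂ f {z : ℂ | 1 < ‖z‖})
  (hfp : ∀ z : ℂ, 1 < ‖z‖ → (z ^ 2 - 1) * deriv f z = 2 * a * f z)

lemma FF_diff (hfd : DifferentiableOn ℂ f {z : ℂ | 1 < ‖z‖}) (A B D : ℂ[X]) :
    DifferentiableOn ℂ (FF f A B D) {z : ℂ | 1 < ‖z‖} := by
  unfold FF
  have hA : ∀ p : ℂ[X], DifferentiableOn ℂ (fun z => p.eval z) {z : ℂ | 1 < ‖z‖} :=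
    fun p => p.differentiable.differentiableOn
  exact ((hA A).add ((hA B).mul hfd)).add ((hA D).mul (hfd.pow 2))

lemma FF_theta (hfd : DifferentiableOn ℂ f {z : ℂ | 1 < ‖z‖})
  (hfp : ∀ z : ℂ, 1 < ‖z‖ → (z ^ 2 - 1) * deriv f z = 2 * a * f z) (A B D : ℂ[X]) (z : ℂ) (hz : 1 < ‖z‖) :
    (z ^ 2 - 1) * deriv (FF f A B D) z = FF f (tau 0 A) (tau (2 * a) B) (tau (4 * a) D) z := by
  have hf := (hfd.differentiableAt (isOpen_U.mem_nhds hz)).hasDerivAt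
  have h := ((A.hasDerivAt z).add ((B.hasDerivAt z).mul hf)).add ((D.hasDerivAt z).mul (hf.pow 2))
  have h2 : deriv (FF f A B D) z = _ := h.deriv
  rw [h2]
  simp only [FF, tau, eval_add, eval_mul, eval_sub, eval_pow, eval_X, eval_one, eval_C]
  have := hfp z hz
  simp only [Pi.pow_apply]
  push_cast
  linear_combination (eval z B + 2 * eval z D * f z) * this

lemma FF_theta_lo (hfd : DifferentiableOn ℂ f {z : ℂ | 1 < ‖z‖})
  (hfp : ∀ z : ℂ, 1 < ‖z‖ → (z ^ 2 - 1) * deriv f z = 2 * a * f z) (A B D : ℂ[X]) (s : ℤ)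
    (h : FF f A B D =o[cobounded ℂ] fun z => z ^ s) :
    FF f (tau 0 A) (tau (2 * a) B) (tau (4 * a) D) =o[cobounded ℂ] fun z => z ^ (s + 1) := by
  refine (theta_lo _ s (FF_diff hfd A B D) h).congr' ?_ (by rfl)
  filter_upwards [eventually_cobounded_le_norm (2:ℝ)] with z hz
  exact FF_theta hfd hfp A B D z (by linarith)

lemma lo_of_mul_f {P : ℂ[X]} {F : ℂ → ℂ} (hF : Tendsto F (cobounded ℂ) (𝓝 1))
    (h : (fun z => P.eval z * F z) =o[cobounded ℂ] fun z => z ^ (0:ℤ)) : P = 0 := by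
  apply poly_zero_of_lo
  have h1 : Tendsto (fun z => (F z)⁻¹) (cobounded ℂ) (𝓝 1) := by
    simpa using hF.inv₀ one_ne_zero
  have h2 : (fun z => (F z)⁻¹) =O[cobounded ℂ] fun z => z ^ (0:ℤ) := by
    simpa using h1.isBigO_one ℂ
  refine (lo_mul 0 h h2 (by ring)).congr' ?_ (by rfl)
  filter_upwards [hF.eventually_ne one_ne_zero] with z hz
  field_simp

lemma zero_lemma (hfd : DifferentiableOn ℂ f {z : ℂ | 1 < ‖z‖})
    (hfp : ∀ z : ℂ, 1 < ‖z‖ → (z ^ 2 - 1) * deriv f z = 2 * a * f z)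
    (hf1 : Tendsto f (cobounded ℂ) (𝓝 1))
    (ha : ∀ k : ℤ, 2 * a ≠ 2 * k) (ha2 : ∀ k : ℤ, 4 * a ≠ 2 * k)
    (A B D : ℂ[X]) (m : ℕ) (hA : A.natDegree ≤ m) (hB : B.natDegree ≤ m) (hD : D.natDegree ≤ m)
    (h : FF f A B D =o[cobounded ℂ] fun z => z ^ (-(2 * m + 3) : ℤ)) : A = 0 := by
  have h1 := FF_theta_lo hfd hfp _ _ _ _ h
  have h2 := FF_theta_lo hfd hfp _ _ _ _ h1
  have hf2 : Tendsto (fun z => f z ^ 2) (cobounded ℂ) (𝓝 1) := by simpa using hf1.pow 2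
  have dA1 := tau_natDegree 0 A m hA
  have dA2 := tau_natDegree 0 _ _ dA1
  have dB1 := tau_natDegree (2 * a) B m hB
  have dB2 := tau_natDegree (2 * a) _ _ dB1
  have oA0 := poly_O A m (by exact_mod_cast hA)
  have oA1 := poly_O (tau 0 A) (m + 1) (by exact_mod_cast dA1)
  have oA2 := poly_O (tau 0 (tau 0 A)) (m + 2) (by exact_mod_cast dA2)
  have oB0 := poly_O B m (by exact_mod_cast hB)
  have oB1 := poly_O (tau (2 * a) B) (m + 1) (by exact_mod_cast dB1)
  have oB2 := poly_O (tau (2 * a) (tau (2 * a) B)) (m + 2) (by exact_mod_cast dB2)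
  have key : A * (tau (2 * a) B * tau (4 * a) (tau (4 * a) D) - tau (2 * a) (tau (2 * a) B) * tau (4 * a) D)
      - tau 0 A * (B * tau (4 * a) (tau (4 * a) D) - tau (2 * a) (tau (2 * a) B) * D)
      + tau 0 (tau 0 A) * (B * tau (4 * a) D - tau (2 * a) B * D) = 0 := by
    apply lo_of_mul_f hf2
    have e1 := lo_mul 0 (lo_mul (-(2 * m + 3) + 1 + m) h1 oA0 rfl) oB2 (by ring)
    have e2 := lo_mul 0 (lo_mul (-(2 * m + 3) + 1 + m) h1 oB0 rfl) oA2 (by ring)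
    have e3 := lo_mul 0 (lo_mul (-(2 * m + 3) + 1 + 1 + m) h2 oA0 rfl) oB1 (by ring)
    have e4 := lo_mul 0 (lo_mul (-(2 * m + 3) + 1 + 1 + m) h2 oB0 rfl) oA1 (by ring)
    have e5 := lo_mul 0 (lo_mul (-(2 * m + 3) + (m + 1)) h oA1 rfl) oB2 (by ring)
    have e6 := lo_mul 0 (lo_mul (-(2 * m + 3) + (m + 1)) h oB1 rfl) oA2 (by ring)
    refine (((e3.sub e4).sub (e1.sub e2)).add (e5.sub e6)).congr' (Eventually.of_forall fun z => ?_) (by rfl)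
    simp only [FF, eval_add, eval_sub, eval_mul]
    ring
  rcases det3 0 (2 * a) (4 * a) A B D (by simpa using ha) (by simpa using ha2)
    (fun k => by have := ha k; intro h; apply this; rw [← h]; ring) key with h0 | h0 | h0
  · exact h0
  · subst h0
    have key2 : A * tau (4 * a) D - tau 0 A * D = 0 := by
      apply lo_of_mul_f hf2
      have e1 := lo_mul _ h1 oA0 rfl
      have e2 := lo_mul (-(2 * m + 3) + 1 + m) h oA1 (by ring)
      refine ((e1.sub e2).trans_isBigO (zpow_O (b := 0) (by omega))).congr' (Eventually.of_forall fun z => ?_) (by rfl)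
      simp only [FF, tau, eval_add, eval_sub, eval_mul]
      simp
      ring
    rcases det2 0 (4 * a) A D (by simpa using ha2) key2 with h0 | h0
    · exact h0
    · subst h0
      apply poly_zero_of_lo
      refine (h.trans_isBigO (zpow_O (b := 0) (by omega))).congr' (Eventually.of_forall fun z => ?_) (by rfl)
      simp [FF]
  · subst h0
    have key2 : A * tau (2 * a) B - tau 0 A * B = 0 := by
      apply lo_of_mul_f hf1
      have e1 := lo_mul _ h1 oA0 rfl
      have e2 := lo_mul (-(2 * m + 3) + 1 + m) h oA1 (by ring)
      refine ((e1.sub e2).trans_isBigO (zpow_O (b := 0) (by omega))).congr' (Eventually.of_forall fun z => ?_) (by rfl)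
      simp only [FF, tau, eval_add, eval_sub, eval_mul]
      simp
      ring
    rcases det2 0 (2 * a) A B (by simpa using ha) key2 with h0 | h0
    · exact h0
    · subst h0
      apply poly_zero_of_lo
      refine (h.trans_isBigO (zpow_O (b := 0) (by omega))).congr' (Eventually.of_forall fun z => ?_) (by rfl)
      simp [FF]
end

/-- the differential operator, acting on the coefficient of `f ^ k` (with `c2`, `c1` from `k`) -/
noncomputable def opS (n c2 c1 c0 al : ℂ) (p : ℂ[X]) : ℂ[X] :=
  (X ^ 2 - 1) ^ 2 * derivative (derivative (derivative p))
  + C 6 * X * (X ^ 2 - 1) * derivative (derivative p) + (C 6 * X ^ 2 - C 2) * derivative p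
  + C c2 * ((X ^ 2 - 1) * derivative (derivative p) + C 2 * X * derivative p) + C c1 * derivative p
  - C (3 * (n * (n + 1))) * ((X ^ 2 - 1) * derivative p + C c0 * p)
  + (C (2 * n * (n ^ 2 - 1)) * X + C (6 * al * (n * (n + 1)))) * p

lemma opS_degree (n : ℕ) (hn : 4 ≤ n) (c2 c1 c0 al : ℂ) (p : ℂ[X]) (hp : p.natDegree ≤ n)
    (hc : c2 - 3 * c0 + 6 * al = 0) : (opS n c2 c1 c0 al p).natDegree ≤ n - 1 := by
  rw [natDegree_le_iff_coeff_eq_zero]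
  intro N hN
  obtain ⟨t, rfl⟩ : ∃ t, N = t + 4 := ⟨N - 4, by omega⟩
  have hexp : opS n c2 c1 c0 al p = 
     derivative (derivative (derivative p)) * X ^ 4 - C 2 * (derivative (derivative (derivative p)) * X ^ 2)
     + derivative (derivative (derivative p))
     + C 6 * (derivative (derivative p) * X ^ 3) - C 6 * (derivative (derivative p) * X ^ 1)
     + C 6 * (derivative p * X ^ 2) - C 2 * derivative p
     + C c2 * (derivative (derivative p) * X ^ 2) - C c2 * (derivative (derivative p))
     + C (c2 * 2) * (derivative p * X ^ 1) + C c1 * derivative p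
     - C (3 * ((n:ℂ) * (n + 1))) * (derivative p * X ^ 2) + C (3 * ((n:ℂ) * (n + 1))) * derivative p
     - C (3 * ((n:ℂ) * (n + 1)) * c0) * p
     + C (2 * (n:ℂ) * (n ^ 2 - 1)) * (p * X ^ 1) + C (6 * al * ((n:ℂ) * (n + 1))) * p := by
    unfold opS
    have hC2 : (C 2 : ℂ[X]) = 2 := rfl
    simp only [C_mul, hC2]
    ring
  have hz : ∀ i, n < i → p.coeff i = 0 := fun i hi => coeff_eq_zero_of_natDegree_lt (by omega)
  rw [hexp]
  have r2 : ∀ q : ℂ[X], (q * X ^ 2).coeff (t + 4) = q.coeff (t + 2) := fun q => coeff_mul_X_pow q 2 (t + 2)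
  have r3 : ∀ q : ℂ[X], (q * X ^ 3).coeff (t + 4) = q.coeff (t + 1) := fun q => coeff_mul_X_pow q 3 (t + 1)
  have r1 : ∀ q : ℂ[X], (q * X ^ 1).coeff (t + 4) = q.coeff (t + 3) := fun q => coeff_mul_X_pow q 1 (t + 3)
  simp only [coeff_add, coeff_sub, coeff_C_mul, coeff_mul_X_pow, r1, r2, r3, coeff_derivative]
  simp only [add_assoc]
  norm_num only
  rw [hz (t + 5) (by omega), hz (t + 6) (by omega), hz (t + 7) (by omega)]
  push_cast
  rcases Nat.lt_or_ge (n + 1) (t + 4) with h | h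
  · rw [hz (t + 4) (by omega), hz (t + 3) (by omega)]; ring
  rcases Nat.lt_or_ge n (t + 4) with h' | h'
  · have : n = t + 3 := by omega
    rw [hz (t + 4) (by omega)]
    subst this
    push_cast
    ring
  · have : n = t + 4 := by omega
    subst this
    push_cast
    have : c2 = 3 * c0 - 6 * al := by linear_combination hc
    rw [this]
    ring

lemma opS_tau (n c al : ℂ) (e2 e1 : ℂ) (p : ℂ[X]) (h2 : e2 = 3 * c - 6 * al)
    (h1 : e1 = 3 * c ^ 2 - 12 * al * c + 8 * al ^ 2) (h0 : c ^ 3 - 6 * al * c ^ 2 + 8 * al ^ 2 * c = 0) (z : ℂ) :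
    (z ^ 2 - 1) * (opS n e2 e1 c al p).eval z =
      (tau c (tau c (tau c p))).eval z - 6 * al * (tau c (tau c p)).eval z
      + (8 * al ^ 2 - 3 * (n * (n + 1)) * (z ^ 2 - 1)) * (tau c p).eval z
      + (z ^ 2 - 1) * (2 * n * (n ^ 2 - 1) * z + 6 * al * (n * (n + 1))) * p.eval z := by
  subst h2 h1
  simp only [opS, tau, derivative_add, derivative_mul, derivative_sub, derivative_X_pow, derivative_one,
    derivative_C, eval_add, eval_mul, eval_sub, eval_pow, eval_X, eval_one, eval_C, eval_zero, derivative_X]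
  simp
  linear_combination (-eval z p) * h0

noncomputable def EE (n : ℕ) (z : ℂ) : ℂ := ((z ^ 2 - 1) ^ (n + 1))⁻¹

noncomputable def sig (n : ℕ) (p : ℂ[X]) : ℂ[X] :=
  (X ^ 2 - 1) * derivative p - C (2 * (n : ℂ) + 2) * X * p

lemma EE_hasDeriv (n : ℕ) (p : ℂ[X]) (z : ℂ) (hz : 1 < ‖z‖) :
    HasDerivAt (fun z => p.eval z * EE n z) ((sig n p).eval z * EE n z / (z ^ 2 - 1)) z := by
  have hq := sq_sub_ne hz
  have h1 : HasDerivAt (fun z : ℂ => (z ^ 2 - 1) ^ (n + 1)) (((n + 1 : ℕ) : ℂ) * (z ^ 2 - 1) ^ n * (2 * z)) z := by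
    have := (((hasDerivAt_id z).pow 2).sub_const 1).pow (n + 1)
    refine this.congr_deriv ?_
    simp
  have h2 := (p.hasDerivAt z).mul (h1.inv (pow_ne_zero _ hq))
  refine h2.congr_deriv ?_
  simp only [sig, EE, eval_add, eval_mul, eval_sub, eval_pow, eval_X, eval_one, eval_C, Pi.inv_apply]
  field_simp
  push_cast
  ring

lemma EE_tendsto (n : ℕ) : Tendsto (fun z : ℂ => z ^ (2 * n + 2) * EE n z) (cobounded ℂ) (𝓝 1) := by
  have h0 : Tendsto (fun z : ℂ => z⁻¹) (cobounded ℂ) (𝓝 0) := tendsto_inv₀_cobounded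
  have h1 : Tendsto (fun z : ℂ => (((1 : ℂ) - z⁻¹ ^ 2) ^ (n + 1))⁻¹) (cobounded ℂ) (𝓝 1) := by
    have := ((((h0.pow 2).const_sub 1).pow (n + 1)).inv₀ (by simp))
    simpa using this
  refine h1.congr' ?_
  filter_upwards [eventually_cobounded_le_norm (2:ℝ)] with z hz
  have hz0 : z ≠ 0 := by rintro rfl; norm_num at hz
  have hq : z ^ 2 - 1 ≠ 0 := sq_sub_ne (by linarith)
  have : (1 : ℂ) - z⁻¹ ^ 2 = (z ^ 2 - 1) / z ^ 2 := by field_simp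
  rw [this, EE, div_pow, inv_div, div_eq_mul_inv, ← pow_mul]
  ring_nf

lemma EE_O (n : ℕ) : EE n =O[cobounded ℂ] fun z => z ^ (-(2 * n + 2) : ℤ) := by
  have h1 := (EE_tendsto n).isBigO_one ℂ
  have h2 := h1.mul (isBigO_refl (fun z : ℂ => z ^ (-(2 * n + 2) : ℤ)) (cobounded ℂ))
  refine h2.congr' ?_ ?_
  · filter_upwards [eventually_ne_cobounded (0:ℂ)] with z hz
    rw [zpow_neg]
    have : z ^ (2 * n + 2 : ℤ) = z ^ (2 * n + 2) := by exact_mod_cast zpow_natCast z (2 * n + 2)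
    rw [this]
    field_simp
  · exact Eventually.of_forall fun z => by simp

lemma ode {a : ℂ} {f : ℂ → ℂ} (hfd : DifferentiableOn ℂ f {z : ℂ | 1 < ‖z‖})
    (hfp : ∀ z : ℂ, 1 < ‖z‖ → (z ^ 2 - 1) * deriv f z = 2 * a * f z)
    (hf1 : Tendsto f (cobounded ℂ) (𝓝 1))
    (ha : ∀ k : ℤ, 2 * a ≠ 2 * k) (ha2 : ∀ k : ℤ, 4 * a ≠ 2 * k)
    (A B D : ℂ[X]) (n : ℕ) (hn : 4 ≤ n)
    (hA : A.natDegree ≤ n) (hB : B.natDegree ≤ n) (hD : D.natDegree ≤ n) (M : ℂ)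
    (hM : Tendsto (fun z : ℂ => z ^ (2 * n + 2) * FF f A B D z) (cobounded ℂ) (𝓝 M)) :
    opS n (-6 * a) (8 * a ^ 2) 0 a A = 0 := by
  have step : ∀ (A B D p : ℂ[X]) (s : ℤ),
      (fun z => FF f A B D z - M * (p.eval z * EE n z)) =o[cobounded ℂ] (fun z => z ^ s) →
      (fun z => FF f (tau 0 A) (tau (2 * a) B) (tau (4 * a) D) z - M * ((sig n p).eval z * EE n z))
        =o[cobounded ℂ] (fun z => z ^ (s + 1)) := by
    intro A B D p s h
    refine (theta_lo _ s ?_ h).congr' ?_ (by rfl)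
    · refine (FF_diff hfd A B D).sub (DifferentiableOn.const_mul ?_ M)
      exact fun z hz => (EE_hasDeriv n p z hz).differentiableAt.differentiableWithinAt
    · filter_upwards [eventually_cobounded_le_norm (2:ℝ)] with z hz
      have hz1 : 1 < ‖z‖ := by linarith
      have hq := sq_sub_ne hz1
      rw [← FF_theta hfd hfp A B D z hz1]
      have d1 := ((FF_diff hfd A B D).differentiableAt (isOpen_U.mem_nhds hz1)).hasDerivAt
      have d2 := (d1.sub ((EE_hasDeriv n p z hz1).const_mul M)).deriv
      have d3 : deriv (fun z => FF f A B D z - M * (p.eval z * EE n z)) z = _ := d2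
      rw [d3]
      field_simp
  have h0 : (fun z => FF f A B D z - M * ((1 : ℂ[X]).eval z * EE n z)) =o[cobounded ℂ]
      (fun z => z ^ (-(2 * n + 2) : ℤ)) := by
    have t1 := hM.sub ((EE_tendsto n).const_mul M)
    rw [mul_one, sub_self] at t1
    have t2 := ((isLittleO_one_iff ℂ).2 t1).mul_isBigO
      (isBigO_refl (fun z : ℂ => z ^ (-(2 * n + 2) : ℤ)) (cobounded ℂ))
    refine t2.congr' ?_ ?_
    · filter_upwards [eventually_ne_cobounded (0:ℂ)] with z hz
      rw [zpow_neg]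
      have : z ^ (2 * n + 2 : ℤ) = z ^ (2 * n + 2) := by exact_mod_cast zpow_natCast z (2 * n + 2)
      rw [this, eval_one]
      field_simp
    · exact Eventually.of_forall fun z => by simp
  have h1 := step _ _ _ _ _ h0
  have h2 := step _ _ _ _ _ h1
  have h3 := step _ _ _ _ _ h2
  refine zero_lemma hfd hfp hf1 ha ha2 _ (opS n 0 (-4 * a ^ 2) (2 * a) a B)
    (opS n (6 * a) (8 * a ^ 2) (4 * a) a D) (n - 1)
    (opS_degree n hn _ _ _ _ A hA (by ring)) (opS_degree n hn _ _ _ _ B hB (by ring))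
    (opS_degree n hn _ _ _ _ D hD (by ring)) ?_
  have hcast : (-(2 * ((n - 1 : ℕ) : ℤ) + 3)) = (-(2 * n + 2) + 3 + (-2) : ℤ) := by omega
  rw [hcast]
  have id1 : ∀ z, (z ^ 2 - 1) * FF f (opS n (-6 * a) (8 * a ^ 2) 0 a A) (opS n 0 (-4 * a ^ 2) (2 * a) a B)
      (opS n (6 * a) (8 * a ^ 2) (4 * a) a D) z =
      FF f (tau 0 (tau 0 (tau 0 A))) (tau (2 * a) (tau (2 * a) (tau (2 * a) B)))
        (tau (4 * a) (tau (4 * a) (tau (4 * a) D))) z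
      - 6 * a * FF f (tau 0 (tau 0 A)) (tau (2 * a) (tau (2 * a) B))
        (tau (4 * a) (tau (4 * a) D)) z
      + (8 * a ^ 2 - 3 * (n * (n + 1)) * (z ^ 2 - 1)) * FF f (tau 0 A) (tau (2 * a) B) (tau (4 * a) D) z
      + (z ^ 2 - 1) * (2 * n * (n ^ 2 - 1) * z + 6 * a * (n * (n + 1))) * FF f A B D z := by
    intro z
    have e0 := opS_tau n 0 a (-6 * a) (8 * a ^ 2) A (by ring) (by ring) (by ring) z
    have e1 := opS_tau n (2 * a) a 0 (-4 * a ^ 2) B (by ring) (by ring) (by ring) z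
    have e2 := opS_tau n (4 * a) a (6 * a) (8 * a ^ 2) D (by ring) (by ring) (by ring) z
    simp only [FF]
    linear_combination e0 + f z * e1 + f z ^ 2 * e2
  set r2 : ℂ := -6 * a * ((2 * n + 2) ^ 2 - (2 * n + 2)) + 6 * a * (n * (n + 1)) with hr2
  set r1 : ℂ := -(2 * ((2 * n + 2) ^ 2 - (2 * n + 2)) + (2 * n + 2) ^ 2) - 8 * a ^ 2 * (2 * n + 2)
    - 3 * (n * (n + 1)) * (2 * n + 2) - 2 * n * (n ^ 2 - 1) with hr1
  set r0 : ℂ := -6 * a * (2 * n + 2) - 6 * a * (n * (n + 1)) with hr0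
  have id2 : ∀ z : ℂ, (sig n (sig n (sig n 1))).eval z - 6 * a * (sig n (sig n 1)).eval z
      + (8 * a ^ 2 - 3 * (n * (n + 1)) * (z ^ 2 - 1)) * (sig n 1).eval z
      + (z ^ 2 - 1) * (2 * n * (n ^ 2 - 1) * z + 6 * a * (n * (n + 1))) * (1 : ℂ[X]).eval z
      = (C r2 * X ^ 2 + C r1 * X + C r0).eval z := by
    intro z
    simp only [sig, derivative_add, derivative_mul, derivative_sub, derivative_X_pow, derivative_one,
      derivative_C, eval_add, eval_mul, eval_sub, eval_pow, eval_X, eval_one, eval_C, eval_zero, derivative_X]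
    simp
    rw [hr2, hr1, hr0]
    ring
  -- the pieces
  have O1 : (fun z : ℂ => (C (8 * a ^ 2) - C (3 * ((n : ℂ) * (n + 1))) * (X ^ 2 - 1)).eval z)
      =O[cobounded ℂ] fun z => z ^ (2 : ℤ) := poly_O _ 2 (by
    exact_mod_cast (by compute_degree : (C (8 * a ^ 2) - C (3 * ((n : ℂ) * (n + 1))) * (X ^ 2 - 1)).natDegree ≤ 2))
  have O0 : (fun z : ℂ => ((X ^ 2 - 1) * (C (2 * (n:ℂ) * (n ^ 2 - 1)) * X + C (6 * a * (n * (n + 1))))).eval z)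
      =O[cobounded ℂ] fun z => z ^ (3 : ℤ) := poly_O _ 3 (by
    exact_mod_cast (by compute_degree :
      ((X ^ 2 - 1) * (C (2 * (n:ℂ) * (n ^ 2 - 1)) * X + C (6 * a * (n * (n + 1))))).natDegree ≤ 3))
  have OR : (fun z : ℂ => (C r2 * X ^ 2 + C r1 * X + C r0).eval z)
      =O[cobounded ℂ] fun z => z ^ (2 : ℤ) := poly_O _ 2 (by
    exact_mod_cast (by compute_degree : (C r2 * X ^ 2 + C r1 * X + C r0).natDegree ≤ 2))
  have g3 : _ =o[cobounded ℂ] fun z => z ^ (-(2 * n + 2) + 3 : ℤ) := h3.trans_isBigO (zpow_O (by omega))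
  have g2 : _ =o[cobounded ℂ] fun z => z ^ (-(2 * n + 2) + 3 : ℤ) :=
    (h2.const_mul_left (6 * a)).trans_isBigO (zpow_O (by omega))
  have g1 := lo_mul (-(2 * n + 2) + 3 : ℤ) h1 O1 (by ring)
  have g0 := lo_mul (-(2 * n + 2) + 3 : ℤ) h0 O0 (by ring)
  have hone : (fun _ : ℂ => (1:ℂ)) =o[cobounded ℂ] fun z => z ^ (1 : ℤ) := by
    simp only [zpow_one]
    rw [isLittleO_const_left]
    right
    exact tendsto_norm_cobounded_atTop
  have gE := ((lo_mul (-(2 * n + 2) + 3 : ℤ) (lo_mul 3 hone OR (by ring)) (EE_O n) (by ring)).const_mul_left M)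
  have tot := (((g3.sub g2).add g1).add g0).add gE
  have hqi : (fun z : ℂ => (z ^ 2 - 1)⁻¹) =O[cobounded ℂ] fun z => z ^ (-2 : ℤ) := by
    have hE : EE 0 = fun z : ℂ => (z ^ 2 - 1)⁻¹ := by funext w; simp [EE]
    have := EE_O 0
    rw [hE] at this
    simpa using this
  refine (lo_mul _ tot hqi rfl).congr' ?_ (by rfl)
  filter_upwards [eventually_cobounded_le_norm (2:ℝ)] with z hz
  have hq : z ^ 2 - 1 ≠ 0 := sq_sub_ne (by linarith)
  rw [← div_eq_mul_inv, div_eq_iff hq, mul_comm (FF _ _ _ _ _), id1 z, ← id2 z]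
  simp only [eval_add, eval_mul, eval_sub, eval_pow, eval_X, eval_one, eval_C]
  ring

lemma logderiv (y : ℂ[X]) (n : ℂ) (hn : n ≠ 0) (hy : ∀ z : ℂ, z.im ≠ 0 → y.eval z ≠ 0) (g : ℂ → ℂ)
    (hg : g = fun z => y.derivative.eval z / (n * y.eval z)) (z : ℂ) (hz : z.im ≠ 0) :
    y.derivative.eval z = n * g z * y.eval z ∧
    y.derivative.derivative.eval z = n * y.eval z * (deriv g z + n * g z ^ 2) ∧
    y.derivative.derivative.derivative.eval z =
      n * y.eval z * (deriv (deriv g) z + 3 * n * g z * deriv g z + n ^ 2 * g z ^ 3) := by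
  have hV : IsOpen {z : ℂ | z.im ≠ 0} := isOpen_ne_fun Complex.continuous_im continuous_const
  have d1 : ∀ w : ℂ, w.im ≠ 0 → deriv g w =
      (y.derivative.derivative.eval w * y.eval w - y.derivative.eval w ^ 2) / (n * y.eval w ^ 2) := by
    intro w hw
    have h0 := hy w hw
    have := ((y.derivative.hasDerivAt w).div ((y.hasDerivAt w).const_mul n) (mul_ne_zero hn h0)).deriv
    have t := (congrArg (fun G => deriv G w) hg).trans this
    refine t.trans ?_
    field_simp
  have h0 := hy z hz
  have e : deriv g =ᶠ[𝓝 z] fun w =>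
      (y.derivative.derivative.eval w * y.eval w - y.derivative.eval w ^ 2) / (n * y.eval w ^ 2) := by
    filter_upwards [hV.mem_nhds hz] with w hw using d1 w hw
  have d2 := e.deriv_eq.trans ((((y.derivative.derivative.hasDerivAt z).mul (y.hasDerivAt z)).sub
      ((y.derivative.hasDerivAt z).pow 2)).div (((y.hasDerivAt z).pow 2).const_mul n)
      (mul_ne_zero hn (pow_ne_zero _ h0))).deriv
  rw [d2, d1 z hz, hg]
  simp only [Pi.mul_apply, Pi.pow_apply, Pi.sub_apply]
  refine ⟨?_, ?_, ?_⟩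
  · field_simp
  · field_simp
    ring
  · field_simp
    push_cast
    ring



/-- For real `α` with `|α| ∈ (0,1/2)` and `f` the branch of `((z−1)/(z+1))^α`
on `ℂ∖[−1,1]` with `f(∞)=1`, let `Q_{n,0}, Q_{n,1}, Q_{n,2}` be type I Hermite–Padé
polynomials of order `n` for `(1,f,f²)`, each `n` a normal index, with all zeros of
`Q_{n,0}` real and outside `[−1,1]` (so `h_n = Q_{n,0}'/(n Q_{n,0})` is holomorphic on
`ℂ∖ℝ`).  If `Λ ⊆ ℕ` is infinite and `h_n → h` locally uniformly on `ℂ∖ℝ` along `Λ`, then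
`(z²−1)² h³ − 3(z²−1) h + 2z = 0` on `ℂ∖ℝ`. -/
theorem stmt_18 (α : ℝ) (hα0 : 0 < |α|) (hα2 : |α| < 1 / 2)
    (f : ℂ → ℂ)
    (hf_dom : DifferentiableOn ℂ f {z : ℂ | ¬(z.im = 0 ∧ |z.re| ≤ 1)})
    (hf_pearson : ∀ z ∈ {z : ℂ | ¬(z.im = 0 ∧ |z.re| ≤ 1)},
      (z ^ 2 - 1) * deriv f z = 2 * (α : ℂ) * f z)
    (hf_inf : Tendsto f (cobounded ℂ) (𝓝 1))
    (Q : ℕ → Fin 3 → Polynomial ℂ)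
    (hQ : ∀ n, ∃ k, Q n k ≠ 0)
    (hdeg : ∀ n k, (Q n k).natDegree = n)
    (hHP : ∀ n, (fun z : ℂ =>
        (Q n 0).eval z + (Q n 1).eval z * f z + (Q n 2).eval z * f z ^ 2)
      =O[cobounded ℂ] fun z => (z ^ (2 * n + 2))⁻¹)
    (hnormal : ∀ n, ∃ M : ℂ, M ≠ 0 ∧
      Tendsto (fun z : ℂ => z ^ (2 * n + 2) *
          ((Q n 0).eval z + (Q n 1).eval z * f z + (Q n 2).eval z * f z ^ 2))
        (cobounded ℂ) (𝓝 M))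
    (hzeros : ∀ n, ∀ z : ℂ, (Q n 0).eval z = 0 → z.im = 0 ∧ 1 < |z.re|)
    (Λ : Set ℕ) (hΛ : Λ.Infinite)
    (h : ℂ → ℂ)
    (hconv : TendstoLocallyUniformlyOn
      (fun (n : ℕ) (z : ℂ) => (Q n 0).derivative.eval z / ((n : ℂ) * (Q n 0).eval z))
      h (atTop ⊓ Filter.principal Λ) {z : ℂ | z.im ≠ 0}) :
    ∀ z : ℂ, z.im ≠ 0 →
      (z ^ 2 - 1) ^ 2 * h z ^ 3 - 3 * (z ^ 2 - 1) * h z + 2 * z = 0 := by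
  have hsub : {z : ℂ | 1 < ‖z‖} ⊆ {z : ℂ | ¬(z.im = 0 ∧ |z.re| ≤ 1)} := by
    rintro z hz ⟨h1, h2⟩
    have h3 : ‖z‖ = |z.re| := by rw [Complex.abs_re_eq_norm.2 h1]
    have hz' : 1 < ‖z‖ := hz
    linarith
  have hfd := hf_dom.mono hsub
  have hfp : ∀ z : ℂ, 1 < ‖z‖ → (z ^ 2 - 1) * deriv f z = 2 * (α : ℂ) * f z :=
    fun z hz => hf_pearson z (hsub hz)
  have hint : ∀ (b : ℝ) (k : ℤ), 0 < |b| → |b| < 1 → b ≠ k := by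
    rintro b k h1 h2 rfl
    have h3 : |k| < 1 := by exact_mod_cast h2
    have h4 : 0 < |k| := by exact_mod_cast h1
    omega
  have ha : ∀ k : ℤ, 2 * (α : ℂ) ≠ 2 * k := by
    intro k hk
    refine hint α k hα0 (by linarith) ?_
    have : (α : ℂ) = k := by linear_combination hk / 2
    exact_mod_cast this
  have ha2 : ∀ k : ℤ, 4 * (α : ℂ) ≠ 2 * k := by
    intro k hk
    refine hint (2 * α) k (by rw [abs_mul, abs_two]; linarith) (by rw [abs_mul, abs_two]; linarith) ?_
    have : 2 * (α : ℂ) = k := by linear_combination hk / 2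
    exact_mod_cast this
  have hode : ∀ n : ℕ, 4 ≤ n → opS n (-6 * α) (8 * (α : ℂ) ^ 2) 0 α (Q n 0) = 0 := by
    intro n hn
    obtain ⟨M, -, hM⟩ := hnormal n
    exact ode hfd hfp hf_inf ha ha2 _ (Q n 1) (Q n 2) n hn (hdeg n 0).le (hdeg n 1).le (hdeg n 2).le M hM
  intro z hz
  set l := atTop ⊓ Filter.principal Λ with hl
  have hne : l.NeBot := by
    rw [hl, ← frequently_mem_iff_neBot]
    exact Nat.frequently_atTop_iff_infinite.2 hΛ
  have hlt : l ≤ atTop := inf_le_left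
  set g : ℕ → ℂ → ℂ := fun n z => (Q n 0).derivative.eval z / ((n : ℂ) * (Q n 0).eval z) with hg
  have hV : IsOpen {z : ℂ | z.im ≠ 0} := isOpen_ne_fun Complex.continuous_im continuous_const
  have hnz : ∀ n, ∀ z : ℂ, z.im ≠ 0 → (Q n 0).eval z ≠ 0 := fun n z hz h0 => hz (hzeros n z h0).1
  have h4 : ∀ᶠ n in l, 4 ≤ n := hlt (eventually_ge_atTop 4)
  have hdiff : ∀ᶠ n in l, DifferentiableOn ℂ (g n) {z : ℂ | z.im ≠ 0} := by
    filter_upwards [h4] with n hn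
    refine DifferentiableOn.div (Polynomial.differentiable _).differentiableOn
      ((Polynomial.differentiable _).differentiableOn.const_mul _) fun w hw => ?_
    exact mul_ne_zero (by norm_cast; omega) (hnz n w hw)
  have c1 := hconv.deriv hdiff hV
  have c2 := c1.deriv (by
    filter_upwards [hdiff] with n hn
    exact hn.deriv hV) hV
  have t0 := hconv.tendsto_at hz
  have t1 := c1.tendsto_at hz
  have t2 := c2.tendsto_at hz
  have ti : Tendsto (fun n : ℕ => (n : ℂ)⁻¹) l (𝓝 0) :=
    (tendsto_inv_atTop_nhds_zero_nat (𝕜 := ℂ)).mono_left hlt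
  have lim : Tendsto (fun n : ℕ =>
      (z ^ 2 - 1) ^ 2 * (g n z ^ 3 + 3 * g n z * deriv (g n) z * (n : ℂ)⁻¹
        + deriv (deriv (g n)) z * (n : ℂ)⁻¹ ^ 2)
      + (6 * z - 6 * α) * (z ^ 2 - 1) * (g n z ^ 2 * (n : ℂ)⁻¹ + deriv (g n) z * (n : ℂ)⁻¹ ^ 2)
      + (6 * z ^ 2 - 2 - 12 * α * z + 8 * (α : ℂ) ^ 2) * (g n z * (n : ℂ)⁻¹ ^ 2)
      - 3 * (1 + (n : ℂ)⁻¹) * (z ^ 2 - 1) * g n z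
      + 2 * (1 - (n : ℂ)⁻¹ ^ 2) * z + 6 * α * ((n : ℂ)⁻¹ + (n : ℂ)⁻¹ ^ 2)) l
      (𝓝 ((z ^ 2 - 1) ^ 2 * (h z ^ 3 + 3 * h z * deriv h z * 0
        + deriv (deriv h) z * 0 ^ 2)
      + (6 * z - 6 * α) * (z ^ 2 - 1) * (h z ^ 2 * 0 + deriv h z * 0 ^ 2)
      + (6 * z ^ 2 - 2 - 12 * α * z + 8 * (α : ℂ) ^ 2) * (h z * 0 ^ 2)
      - 3 * (1 + 0) * (z ^ 2 - 1) * h z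
      + 2 * (1 - 0 ^ 2) * z + 6 * α * (0 + 0 ^ 2))) := by
    refine Tendsto.add (Tendsto.add (Tendsto.sub (Tendsto.add (Tendsto.add ?_ ?_) ?_) ?_) ?_) ?_
    · exact (((t0.pow 3).add (((t0.const_mul 3).mul t1).mul ti)).add (t2.mul (ti.pow 2))).const_mul _
    · exact (((t0.pow 2).mul ti).add (t1.mul (ti.pow 2))).const_mul _
    · exact (t0.mul (ti.pow 2)).const_mul _
    · exact (((ti.const_add 1).const_mul 3).mul_const _).mul t0
    · exact (((ti.pow 2).const_sub 1).const_mul 2).mul_const z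
    · exact (ti.add (ti.pow 2)).const_mul _
  have zero : ∀ᶠ n : ℕ in l, (0 : ℂ) =
      (z ^ 2 - 1) ^ 2 * (g n z ^ 3 + 3 * g n z * deriv (g n) z * (n : ℂ)⁻¹
        + deriv (deriv (g n)) z * (n : ℂ)⁻¹ ^ 2)
      + (6 * z - 6 * α) * (z ^ 2 - 1) * (g n z ^ 2 * (n : ℂ)⁻¹ + deriv (g n) z * (n : ℂ)⁻¹ ^ 2)
      + (6 * z ^ 2 - 2 - 12 * α * z + 8 * (α : ℂ) ^ 2) * (g n z * (n : ℂ)⁻¹ ^ 2)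
      - 3 * (1 + (n : ℂ)⁻¹) * (z ^ 2 - 1) * g n z
      + 2 * (1 - (n : ℂ)⁻¹ ^ 2) * z + 6 * α * ((n : ℂ)⁻¹ + (n : ℂ)⁻¹ ^ 2) := by
    filter_upwards [h4] with n hn
    have hn0 : (n : ℂ) ≠ 0 := by norm_cast; omega
    obtain ⟨e1, e2, e3⟩ := logderiv (Q n 0) n hn0 (hnz n) (g n) rfl z hz
    have ho := congrArg (eval z) (hode n hn)
    simp only [opS, eval_add, eval_mul, eval_sub, eval_pow, eval_X, eval_one, eval_C, eval_zero,
      e1, e2, e3] at ho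
    have hy := hnz n z hz
    have hprod : (n : ℂ) ^ 3 * (Q n 0).eval z ≠ 0 := mul_ne_zero (pow_ne_zero _ hn0) hy
    generalize g n z = G at *
    generalize deriv (g n) z = G1 at *
    generalize deriv (deriv (g n)) z = G2 at *
    generalize (Q n 0).eval z = Y at *
    apply mul_left_cancel₀ hprod
    rw [mul_zero, ← ho]
    field_simp
    ring
  have lim0 := tendsto_nhds_unique (tendsto_const_nhds.congr' zero) lim
  rw [lim0]
  ring
end
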